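/- arXiv:2507.14508 — 14 statements merged into one kernel-verified Lean document; each statement's English description precedes it below -/
import Mathlib

section
/- Let Y be a complex inner product space and a ∈ Y with ‖a‖ < 1. Then the Möbius transform φ_a is Fréchet differentiable at 0 and its differential there is dφ_a(0) = −s_a² P_a − s_a Q_a as a continuous linear map Y → Y. -/
open scoped InnerProductSpace Classical

/-- Orthogonal projection onto the line spanned by `a`, with the paper's convention that
`⟨z, a⟩` is linear in the first argument (so `⟪a, z⟫_ℂ` in Mathlib's convention). -/
noncomputable def mobiusP {Y : Type*} [NormedAddCommGroup Y] [InnerProductSpace ℂ Y]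
    (a z : Y) : Y :=
  if a = 0 then 0 else ((⟪a, z⟫_ℂ) / (⟪a, a⟫_ℂ)) • a

/-- The orthogonal complement `Q_a = Id - P_a`. -/
noncomputable def mobiusQ {Y : Type*} [NormedAddCommGroup Y] [InnerProductSpace ℂ Y]
    (a z : Y) : Y := z - mobiusP a z

/-- The Möbius transform `φ_a(z) = (a - P_a z - s_a Q_a z) / (1 - ⟨z, a⟩)`,
where `s_a = √(1 - ‖a‖²)`. -/
noncomputable def mobius {Y : Type*} [NormedAddCommGroup Y] [InnerProductSpace ℂ Y]
    (a z : Y) : Y :=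
  (1 - ⟪a, z⟫_ℂ)⁻¹ • (a - mobiusP a z - (Real.sqrt (1 - ‖a‖ ^ 2) : ℂ) • mobiusQ a z)

/-- The projection `P_a` as a continuous linear map. -/
noncomputable def mobiusPCLM {Y : Type*} [NormedAddCommGroup Y] [InnerProductSpace ℂ Y]
    (a : Y) : Y →L[ℂ] Y :=
  (⟪a, a⟫_ℂ)⁻¹ • (innerSL ℂ a).smulRight a

theorem mobiusPCLM_apply {Y : Type*} [NormedAddCommGroup Y] [InnerProductSpace ℂ Y]
    (a z : Y) : mobiusPCLM a z = mobiusP a z := by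
  by_cases h : a = 0
  · simp [mobiusPCLM, mobiusP, h]
  · simp [mobiusPCLM, mobiusP, h, smul_smul, div_eq_inv_mul]

theorem inner_smul_eq_norm_sq_smul_mobiusP {Y : Type*} [NormedAddCommGroup Y]
    [InnerProductSpace ℂ Y] (a z : Y) :
    ⟪a, z⟫_ℂ • a = ((‖a‖ ^ 2 : ℝ) : ℂ) • mobiusP a z := by
  by_cases h : a = 0
  · simp [h]
  · have h' : ⟪a, a⟫_ℂ ≠ 0 := inner_self_ne_zero.mpr h
    have hn : ((‖a‖ ^ 2 : ℝ) : ℂ) = ⟪a, a⟫_ℂ := by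
      rw [inner_self_eq_norm_sq_to_K]; push_cast; rfl
    rw [hn, mobiusP, if_neg h, smul_smul, mul_div_cancel₀ _ h']

/-- The Möbius transform `φ_a` is Fréchet differentiable at `0` with differential
`dφ_a(0) = -s_a² P_a - s_a Q_a`. -/
theorem stmt3 {Y : Type*} [NormedAddCommGroup Y] [InnerProductSpace ℂ Y]
    (a : Y) (ha : ‖a‖ < 1) :
    ∃ T : Y →L[ℂ] Y,
      (∀ z : Y, T z = -((Real.sqrt (1 - ‖a‖ ^ 2) ^ 2 : ℝ) : ℂ) • mobiusP a z
          - ((Real.sqrt (1 - ‖a‖ ^ 2) : ℝ) : ℂ) • mobiusQ a z) ∧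
      HasFDerivAt (mobius a) T 0 := by
  set s : ℝ := Real.sqrt (1 - ‖a‖ ^ 2) with hs
  have hs2 : s ^ 2 = 1 - ‖a‖ ^ 2 := Real.sq_sqrt (by nlinarith [norm_nonneg a])
  refine ⟨-((s ^ 2 : ℝ) : ℂ) • mobiusPCLM a
    - (s : ℂ) • (ContinuousLinearMap.id ℂ Y - mobiusPCLM a), fun z => ?_, ?_⟩
  · simp [mobiusPCLM_apply, mobiusQ]
  · have hden : HasFDerivAt (fun z : Y => (1 - ⟪a, z⟫_ℂ)⁻¹) (innerSL ℂ a) 0 := by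
      have h1 : HasFDerivAt (fun z : Y => 1 - ⟪a, z⟫_ℂ) (-(innerSL ℂ a)) 0 :=
        (innerSL ℂ a).hasFDerivAt.const_sub 1
      have h2 : HasDerivAt (fun w : ℂ => w⁻¹) (-1) (1 - ⟪a, (0 : Y)⟫_ℂ) := by
        simpa using hasDerivAt_inv (one_ne_zero (α := ℂ))
      simpa [Function.comp_def] using h2.comp_hasFDerivAt (0 : Y) h1
    have hnum : HasFDerivAt (fun z : Y => a - mobiusP a z - (s : ℂ) • mobiusQ a z)
        (-mobiusPCLM a - (s : ℂ) • (ContinuousLinearMap.id ℂ Y - mobiusPCLM a)) 0 := by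
      simp only [mobiusQ, ← mobiusPCLM_apply]
      exact ((mobiusPCLM a).hasFDerivAt.const_sub a).sub
        (((hasFDerivAt_id _).sub (mobiusPCLM a).hasFDerivAt).const_smul (s : ℂ))
    refine (hden.smul hnum).congr_fderiv ?_
    ext z
    have h0 : mobiusP a 0 = 0 := by rw [← mobiusPCLM_apply, map_zero]
    have hz := inner_smul_eq_norm_sq_smul_mobiusP a z
    simp only [mobiusQ, h0, inner_zero_right, sub_zero, inv_one, one_smul, smul_zero,
      add_apply, sub_apply, neg_apply, smul_apply,
      ContinuousLinearMap.smulRight_apply, innerSL_apply_apply, hz, hs2, mobiusPCLM_apply,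
      ContinuousLinearMap.id_apply]
    push_cast
    module
end

section
/- Let Y be a complex inner product space and a ∈ Y with ‖a‖ < 1. The operator norm of the continuous linear map T = −s_a² P_a − s_a Q_a : Y → Y equals 1 − ‖a‖² if dim Y = 1, and equals √(1 − ‖a‖²) if dim Y > 1 (including infinite dimension). -/
open scoped InnerProductSpace Classical

theorem ContinuousLinearMap.norm_eq_of_le_of_apply {Y : Type*} [NormedAddCommGroup Y]
    [InnerProductSpace ℂ Y] (T : Y →L[ℂ] Y) {c : ℝ} (hc : 0 ≤ c)
    (hle : ∀ z, ‖T z‖ ≤ c * ‖z‖) {v : Y} (hv : v ≠ 0) (hTv : ‖T v‖ = c * ‖v‖) : ‖T‖ = c := by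
  refine le_antisymm (T.opNorm_le_bound hc hle) ?_
  have h := T.le_opNorm v
  rw [hTv] at h
  exact le_of_mul_le_mul_right h (norm_pos_iff.mpr hv)

theorem inner_mobiusQ_right {Y : Type*} [NormedAddCommGroup Y] [InnerProductSpace ℂ Y]
    (a z : Y) : ⟪a, mobiusQ a z⟫_ℂ = 0 := by
  unfold mobiusQ mobiusP
  split_ifs with h
  · simp [h]
  · rw [inner_sub_right, inner_smul_right, div_mul_cancel₀ _ (inner_self_ne_zero.mpr h), sub_self]

theorem mobiusP_eq_zero {Y : Type*} [NormedAddCommGroup Y] [InnerProductSpace ℂ Y]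
    {a z : Y} (h : ⟪a, z⟫_ℂ = 0) : mobiusP a z = 0 := by
  simp [mobiusP, h]

theorem mobiusP_smul_self {Y : Type*} [NormedAddCommGroup Y] [InnerProductSpace ℂ Y]
    (a : Y) (c : ℂ) : mobiusP a (c • a) = c • a := by
  unfold mobiusP
  split_ifs with h
  · simp [h]
  · rw [inner_smul_right, mul_div_cancel_right₀ _ (inner_self_ne_zero.mpr h)]

theorem exists_mobiusP_eq_smul {Y : Type*} [NormedAddCommGroup Y] [InnerProductSpace ℂ Y]
    (a z : Y) : ∃ c : ℂ, mobiusP a z = c • a := by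
  unfold mobiusP
  split_ifs
  · exact ⟨0, (zero_smul ℂ a).symm⟩
  · exact ⟨_, rfl⟩

theorem inner_mobiusP_mobiusQ {Y : Type*} [NormedAddCommGroup Y] [InnerProductSpace ℂ Y]
    (a z : Y) : ⟪mobiusP a z, mobiusQ a z⟫_ℂ = 0 := by
  obtain ⟨c, hc⟩ := exists_mobiusP_eq_smul a z
  rw [hc, inner_smul_left, inner_mobiusQ_right, mul_zero]

theorem norm_smul_mobiusP_add_smul_mobiusQ_sq {Y : Type*} [NormedAddCommGroup Y]
    [InnerProductSpace ℂ Y] (a z : Y) (α β : ℂ) :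
    ‖α • mobiusP a z + β • mobiusQ a z‖ ^ 2 =
      ‖α‖ ^ 2 * ‖mobiusP a z‖ ^ 2 + ‖β‖ ^ 2 * ‖mobiusQ a z‖ ^ 2 := by
  have h := norm_add_sq_eq_norm_sq_add_norm_sq_of_inner_eq_zero
    (𝕜 := ℂ) (α • mobiusP a z) (β • mobiusQ a z)
    (by rw [inner_smul_left, inner_smul_right, inner_mobiusP_mobiusQ]; simp)
  rw [norm_smul, norm_smul] at h
  linear_combination h

/-- The operator norm of `T = -s_a² P_a - s_a Q_a` is `1 - ‖a‖²` when `dim Y = 1`,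
and `√(1 - ‖a‖²)` when `dim Y > 1` (including infinite dimension). -/
theorem stmt4 {Y : Type*} [NormedAddCommGroup Y] [InnerProductSpace ℂ Y]
    (a : Y) (ha : ‖a‖ < 1) (T : Y →L[ℂ] Y)
    (hT : ∀ z : Y, T z = -((Real.sqrt (1 - ‖a‖ ^ 2) ^ 2 : ℝ) : ℂ) • mobiusP a z
          - ((Real.sqrt (1 - ‖a‖ ^ 2) : ℝ) : ℂ) • mobiusQ a z) :
    (Module.rank ℂ Y = 1 → ‖T‖ = 1 - ‖a‖ ^ 2) ∧
    (1 < Module.rank ℂ Y → ‖T‖ = Real.sqrt (1 - ‖a‖ ^ 2)) := by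
  set s := Real.sqrt (1 - ‖a‖ ^ 2) with hs
  have hs2 : s ^ 2 = 1 - ‖a‖ ^ 2 := Real.sq_sqrt (by nlinarith [norm_nonneg a])
  have hs0 : 0 ≤ s := Real.sqrt_nonneg _
  have hs1 : s ^ 2 ≤ 1 := by nlinarith [norm_nonneg a]
  constructor
  · intro hrank
    obtain ⟨v, hv0, hv⟩ := rank_eq_one_iff.mp hrank
    have hT' : ∀ z, ‖T z‖ = (1 - ‖a‖ ^ 2) * ‖z‖ := by
      intro z
      by_cases h0 : a = 0
      · have hs1' : s = 1 := by simp [hs, h0]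
        rw [hT, hs1']
        simp [mobiusQ, mobiusP, h0]
      · obtain ⟨r, hr⟩ := hv a
        obtain ⟨t, ht⟩ := hv z
        have hr0 : r ≠ 0 := by
          rintro rfl
          exact h0 (by rw [← hr, zero_smul])
        have hz : z = (t / r) • a := by
          rw [← hr, smul_smul, div_mul_cancel₀ _ hr0, ht]
        have hP : mobiusP a z = z := by rw [hz, mobiusP_smul_self]
        rw [hT, mobiusQ, hP, sub_self, smul_zero, sub_zero, norm_smul, norm_neg,
          Complex.norm_real, Real.norm_of_nonneg (sq_nonneg s), hs2]
    exact T.norm_eq_of_le_of_apply (hs2 ▸ sq_nonneg s) (fun z => (hT' z).le) hv0 (hT' v)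
  · intro hrank
    obtain ⟨w, hw⟩ : ∃ w : Y, ∀ c : ℂ, c • a ≠ w := by
      by_contra! h
      exact hrank.not_ge (rank_le_one_iff.mpr ⟨a, h⟩)
    have hq0 : mobiusQ a w ≠ 0 := by
      intro h
      obtain ⟨c, hc⟩ := exists_mobiusP_eq_smul a w
      exact hw c (hc ▸ (sub_eq_zero.mp h).symm)
    refine T.norm_eq_of_le_of_apply hs0 (fun z => ?_) hq0 ?_
    · refine le_of_sq_le_sq ?_ (by positivity)
      have hTz := norm_smul_mobiusP_add_smul_mobiusQ_sq a z (-((s ^ 2 : ℝ) : ℂ)) (-(s : ℂ))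
      have hz := norm_smul_mobiusP_add_smul_mobiusQ_sq a z 1 1
      rw [neg_smul (s : ℂ), ← sub_eq_add_neg, ← hT, norm_neg, norm_neg, Complex.norm_real,
        Complex.norm_real, Real.norm_of_nonneg (sq_nonneg s), Real.norm_of_nonneg hs0] at hTz
      rw [one_smul, one_smul, mobiusQ, add_sub_cancel, ← mobiusQ, norm_one, one_pow, one_mul,
        one_mul] at hz
      rw [hTz, mul_pow, hz]
      nlinarith [mul_nonneg (mul_nonneg (sq_nonneg s) (sub_nonneg.mpr hs1))
        (sq_nonneg ‖mobiusP a z‖)]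
    · have hP := mobiusP_eq_zero (inner_mobiusQ_right a w)
      rw [hT, mobiusQ.eq_def a (mobiusQ a w), hP, smul_zero, zero_sub, sub_zero, norm_neg,
        norm_smul, Complex.norm_real, Real.norm_of_nonneg hs0]
end

section
/- (Schwarz–Pick lemma, one-dimensional range) Let X be a complex normed space and let f be analytic on the open unit ball B_X(0,1) with values in ℂ, with |f(z)| ≤ 1 for all z ∈ B_X(0,1). Then the operator norm of its Fréchet differential at 0 satisfies ‖df(0)‖ ≤ 1 − |f(0)|². -/
open Metric Set Filter Topology ComplexConjugate

/-- A Blaschke factor maps the closed unit disc to itself. -/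
theorem norm_sub_le_norm_one_sub_conj_mul {a w : ℂ} (ha : ‖a‖ ≤ 1) (hw : ‖w‖ ≤ 1) :
    ‖w - a‖ ≤ ‖1 - conj a * w‖ := by
  have key : ‖1 - conj a * w‖ ^ 2 - ‖w - a‖ ^ 2 = (1 - ‖a‖ ^ 2) * (1 - ‖w‖ ^ 2) := by
    simp only [Complex.sq_norm, Complex.normSq_apply, Complex.sub_re, Complex.sub_im,
      Complex.mul_re, Complex.mul_im, Complex.conj_re, Complex.conj_im, Complex.one_re,
      Complex.one_im]
    ring
  have h₁ : 0 ≤ 1 - ‖a‖ ^ 2 := sub_nonneg.2 (pow_le_one₀ (norm_nonneg _) ha)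
  have h₂ : 0 ≤ 1 - ‖w‖ ^ 2 := sub_nonneg.2 (pow_le_one₀ (norm_nonneg _) hw)
  exact le_of_sq_le_sq (by linarith [mul_nonneg h₁ h₂]) (norm_nonneg _)

/-- The **Schwarz-Pick lemma** at the centre of the unit ball, for a function whose value at the
centre lies in the open unit disc. -/
theorem norm_fderiv_le_one_sub_sq_of_norm_lt_one {X : Type*} [NormedAddCommGroup X]
    [NormedSpace ℂ X] {f : X → ℂ} (hf : DifferentiableOn ℂ f (ball 0 1))
    (hb : ∀ z ∈ ball (0 : X) 1, ‖f z‖ ≤ 1) (h₀ : ‖f 0‖ < 1) :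
    ‖fderiv ℂ f 0‖ ≤ 1 - ‖f 0‖ ^ 2 := by
  set a := f 0 with ha
  have hden : ∀ w : ℂ, ‖w‖ ≤ 1 → 1 - conj a * w ≠ 0 := by
    intro w hw h
    have h₁ : ‖conj a * w‖ = 1 := by rw [← sub_eq_zero.1 h, norm_one]
    rw [norm_mul, RCLike.norm_conj] at h₁
    nlinarith [norm_nonneg a]
  have hpos : 0 < 1 - ‖a‖ ^ 2 := sub_pos.2 (pow_lt_one₀ (norm_nonneg _) h₀ two_ne_zero)
  have haa : 1 - conj a * a = ((1 - ‖a‖ ^ 2 : ℝ) : ℂ) := by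
    rw [Complex.conj_mul']
    push_cast
    rfl
  let φ : ℂ → ℂ := fun w ↦ (w - a) / (1 - conj a * w)
  have hφd : ∀ w : ℂ, ‖w‖ ≤ 1 → DifferentiableAt ℂ φ w := fun w hw ↦
    DifferentiableAt.div (by fun_prop) (by fun_prop) (hden w hw)
  have hφa : HasDerivAt φ ((1 - ‖a‖ ^ 2 : ℝ) : ℂ)⁻¹ a := by
    have h := ((hasDerivAt_id a).sub_const a).fun_div
      (((hasDerivAt_id a).const_mul (conj a)).const_sub 1) (hden a h₀.le)
    refine h.congr_deriv ?_
    have hne := hden a h₀.le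
    rw [← haa]
    simp only [id]
    field_simp
    ring
  have hg : DifferentiableOn ℂ (φ ∘ f) (ball 0 1) := fun z hz ↦
    (hφd _ (hb z hz)).comp_differentiableWithinAt z (hf z hz)
  have hg₀ : (φ ∘ f) 0 = 0 := by simp [φ, ← ha]
  have hmaps : MapsTo (φ ∘ f) (ball 0 1) (closedBall ((φ ∘ f) 0) 1) := fun z hz ↦ by
    rw [hg₀, mem_closedBall_zero_iff]
    simp only [φ, Function.comp_apply, norm_div]
    exact div_le_one_of_le₀ (norm_sub_le_norm_one_sub_conj_mul h₀.le (hb z hz)) (norm_nonneg _)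
  have hle := Complex.norm_fderiv_le_one_of_mapsTo_ball hg hmaps one_pos
  have hfd : HasFDerivAt f (fderiv ℂ f 0) 0 :=
    (hf.differentiableAt (ball_mem_nhds _ one_pos)).hasFDerivAt
  rw [(HasDerivAt.comp_hasFDerivAt (0 : X) hφa hfd).fderiv, norm_smul, norm_inv,
    Complex.norm_of_nonneg hpos.le, inv_mul_le_one₀ hpos] at hle
  exact hle

/-- Schwarz–Pick lemma, one-dimensional range: if `f` is analytic on the open unit ball of a
complex normed space with values in `ℂ` and bounded by `1`, then
`‖df(0)‖ ≤ 1 - |f(0)|²`. -/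
theorem stmt5 {X : Type*} [NormedAddCommGroup X] [NormedSpace ℂ X]
    (f : X → ℂ) (df : X → X →L[ℂ] ℂ)
    (hf : ∀ z ∈ Metric.ball (0 : X) 1, HasFDerivAt f (df z) z)
    (hb : ∀ z ∈ Metric.ball (0 : X) 1, ‖f z‖ ≤ 1) :
    ‖df 0‖ ≤ 1 - ‖f 0‖ ^ 2 := by
  have h0 : (0 : X) ∈ ball (0 : X) 1 := mem_ball_self one_pos
  have hscaled : ∀ t ∈ Ioo (0 : ℝ) 1, t * ‖df 0‖ ≤ 1 - (t * ‖f 0‖) ^ 2 := by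
    intro t ht
    have hnorm : ∀ z, ‖(t : ℂ) • f z‖ = t * ‖f z‖ := fun z ↦ by
      rw [norm_smul, Complex.norm_of_nonneg ht.1.le]
    have h := norm_fderiv_le_one_sub_sq_of_norm_lt_one (f := fun z ↦ (t : ℂ) • f z)
      (fun z hz ↦ ((hf z hz).const_smul (t : ℂ)).differentiableAt.differentiableWithinAt)
      (fun z hz ↦ (hnorm z).trans_le (mul_le_one₀ ht.2.le (norm_nonneg _) (hb z hz)))
      ((hnorm 0).trans_lt (by nlinarith [ht.1, ht.2, hb 0 h0]))
    rwa [((hf 0 h0).fun_const_smul (t : ℂ)).fderiv, norm_smul, hnorm,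
      Complex.norm_of_nonneg ht.1.le] at h
  have hl : Tendsto (fun t : ℝ ↦ t * ‖df 0‖) (𝓝[<] 1) (𝓝 (1 * ‖df 0‖)) :=
    (Continuous.tendsto (by fun_prop) 1).mono_left nhdsWithin_le_nhds
  have hr : Tendsto (fun t : ℝ ↦ 1 - (t * ‖f 0‖) ^ 2) (𝓝[<] 1) (𝓝 (1 - (1 * ‖f 0‖) ^ 2)) :=
    (Continuous.tendsto (f := fun t : ℝ ↦ 1 - (t * ‖f 0‖) ^ 2) (by fun_prop) 1).mono_left
      nhdsWithin_le_nhds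
  simpa using le_of_tendsto_of_tendsto hl hr
    (eventually_of_mem (Ioo_mem_nhdsLT one_pos) hscaled)
end

section
/- (Schwarz–Pick lemma, inner product range) Let X be a complex normed space and Y a complex inner product space, and let f be analytic on the open unit ball B_X(0,1) with values in Y, with ‖f(z)‖ ≤ 1 for all z ∈ B_X(0,1). Then the operator norm of its Fréchet differential at 0 satisfies ‖df(0)‖ ≤ √(1 − ‖f(0)‖²). -/
open scoped InnerProductSpace in
/-- Scalar-slice form of the Schwarz–Pick estimate: the values `f 0` and `df(0) x` of a map bounded
by `1` satisfy a Parseval-type inequality for every `x` in the open unit ball. -/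
theorem norm_sq_add_norm_fderiv_apply_sq_le_one {X Y : Type*} [NormedAddCommGroup X]
    [NormedSpace ℂ X] [NormedAddCommGroup Y] [InnerProductSpace ℂ Y] {f : X → Y} {L : X →L[ℂ] Y}
    (hf : DifferentiableOn ℂ f (Metric.ball 0 1)) (hL : HasFDerivAt f L 0)
    (hb : ∀ z ∈ Metric.ball (0 : X) 1, ‖f z‖ ≤ 1) {x : X} (hx : ‖x‖ < 1) :
    ‖f 0‖ ^ 2 + ‖L x‖ ^ 2 ≤ 1 := by
  set U : Set ℂ := (fun z : ℂ ↦ z • x) ⁻¹' Metric.ball 0 1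
  have hUo : IsOpen U := Metric.isOpen_ball.preimage (by fun_prop)
  have hcl : Metric.closedBall (0 : ℂ) 1 ⊆ U := fun z hz ↦ by
    simp only [U, Set.mem_preimage, mem_ball_zero_iff, norm_smul]
    rw [mem_closedBall_zero_iff] at hz
    nlinarith [norm_nonneg x]
  have hU0 : U ∈ nhds (0 : ℂ) := hUo.mem_nhds (hcl (by simp))
  have hg : DifferentiableOn ℂ (fun z : ℂ ↦ f (z • x)) U :=
    hf.comp (by fun_prop : DifferentiableOn ℂ (fun z : ℂ ↦ z • x) U) (fun z hz ↦ hz)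
  have hinner (b : Y) : DifferentiableOn ℂ (fun z : ℂ ↦ ⟪b, f (z • x)⟫_ℂ) U :=
    (innerSL ℂ b).differentiable.comp_differentiableOn hg
  have hderiv : HasDerivAt (fun z : ℂ ↦ ⟪L x, f (z • x)⟫_ℂ) ⟪L x, L x⟫_ℂ 0 := by
    have h1 : HasDerivAt (fun z : ℂ ↦ z • x) x 0 := by
      simpa using (hasDerivAt_id (0 : ℂ)).smul_const x
    have h2 : HasDerivAt (fun z : ℂ ↦ f (z • x)) (L x) 0 :=
      HasFDerivAt.comp_hasDerivAt (0 : ℂ) (by simpa using hL) h1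
    exact (innerSL ℂ (L x)).hasFDerivAt.comp_hasDerivAt (0 : ℂ) h2
  set q : ℂ → ℂ := dslope (fun z : ℂ ↦ ⟪L x, f (z • x)⟫_ℂ) 0
  set H : ℂ → ℂ := fun z ↦ ⟪f 0, f (z • x)⟫_ℂ + q z
  have hH : DifferentiableOn ℂ H U :=
    (hinner _).add ((Complex.differentiableOn_dslope hU0).2 (hinner _))
  have hH0 : (H 0).re = ‖f 0‖ ^ 2 + ‖L x‖ ^ 2 := by
    simp only [H, q, dslope_same, hderiv.deriv, zero_smul, inner_self_eq_norm_sq_to_K]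
    norm_cast
  have hre : ∀ z ∈ frontier (Metric.ball (0 : ℂ) 1),
      (H z).re ≤ (1 + ‖f 0‖ ^ 2 + ‖L x‖ ^ 2) / 2 := fun z hz ↦ by
    rw [frontier_ball _ one_ne_zero, mem_sphere_zero_iff_norm] at hz
    have hz0 : z ≠ 0 := by rintro rfl; simp at hz
    have hq : q z = (starRingEnd ℂ) z * (⟪L x, f (z • x)⟫_ℂ - ⟪L x, f 0⟫_ℂ) := by
      simp [q, dslope_of_ne _ hz0, slope_def_module, Complex.inv_eq_conj hz]
    have hnn : 0 ≤ ‖f (z • x) - (f 0 + z • L x)‖ ^ 2 := sq_nonneg _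
    have hfz : ‖f (z • x)‖ ^ 2 ≤ 1 :=
      pow_le_one₀ (norm_nonneg _) (hb _ (hcl (by simp [hz])))
    have hsq : ‖f 0 + z • L x‖ ^ 2 =
        ‖f 0‖ ^ 2 + 2 * (starRingEnd ℂ z * ⟪L x, f 0⟫_ℂ).re + ‖L x‖ ^ 2 := by
      rw [@norm_add_sq ℂ, norm_smul, hz, one_mul, ← inner_conj_symm (f 0), inner_smul_left]
      simp only [RCLike.conj_re]
      rfl
    have hcross : RCLike.re ⟪f (z • x), f 0 + z • L x⟫_ℂ =
        (⟪f 0, f (z • x)⟫_ℂ + starRingEnd ℂ z * ⟪L x, f (z • x)⟫_ℂ).re := by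
      rw [← inner_conj_symm (f (z • x)), inner_add_left, inner_smul_left]
      simp only [RCLike.conj_re]
      rfl
    rw [@norm_sub_sq ℂ, hsq, hcross] at hnn
    simp only [H, hq, mul_sub, Complex.add_re, Complex.sub_re] at hnn ⊢
    linarith
  have hmax := Complex.norm_le_of_forall_mem_frontier_norm_le (f := fun z ↦ Complex.exp (H z))
    Metric.isBounded_ball (hH.cexp.diffContOnCl_ball hcl)
    (C := Real.exp ((1 + ‖f 0‖ ^ 2 + ‖L x‖ ^ 2) / 2))
    (fun z hz ↦ by simpa [Complex.norm_exp] using hre z hz)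
    (subset_closure (Metric.mem_ball_self one_pos))
  rw [Complex.norm_exp, Real.exp_le_exp, hH0] at hmax
  linarith

/-- Schwarz–Pick lemma, inner product range: if `f` is analytic on the open unit ball of a
complex normed space with values in a complex inner product space and bounded by `1`, then
`‖df(0)‖ ≤ √(1 - ‖f(0)‖²)`. -/
theorem stmt6 {X Y : Type*} [NormedAddCommGroup X] [NormedSpace ℂ X]
    [NormedAddCommGroup Y] [InnerProductSpace ℂ Y]
    (f : X → Y) (df : X → X →L[ℂ] Y)
    (hf : ∀ z ∈ Metric.ball (0 : X) 1, HasFDerivAt f (df z) z)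
    (hb : ∀ z ∈ Metric.ball (0 : X) 1, ‖f z‖ ≤ 1) :
    ‖df 0‖ ≤ Real.sqrt (1 - ‖f 0‖ ^ 2) := by
  rw [← (df 0).sSup_unit_ball_eq_norm]
  refine csSup_le ((Metric.nonempty_ball.2 one_pos).image _) ?_
  rintro _ ⟨x, hx, rfl⟩
  refine Real.le_sqrt_of_sq_le ?_
  have := norm_sq_add_norm_fderiv_apply_sq_le_one
    (fun z hz ↦ (hf z hz).differentiableAt.differentiableWithinAt)
    (hf 0 (Metric.mem_ball_self one_pos)) hb (mem_ball_zero_iff.1 hx)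
  linarith
end

section
/- Let (X, d_X) and (Y, d_Y) be metric spaces, w : X → (0, ∞) a continuous function, φ a majorant, and M, C ≥ 0 constants. Assume that for all x, y ∈ X there exist L ≥ 0 and a curve γ : [0, L] → X parametrized by arc length with γ(0) = x, γ(L) = y and ∫_0^L w(γ(s)) ds ≤ M·φ(d_X(x, y)). If f : X → Y satisfies d*f(x) ≤ C·w(x) for every x ∈ X, then d_Y(f(x), f(y)) ≤ M·C·φ(d_X(x, y)) for all x, y ∈ X. -/
open Filter Topology

/-- A bound on the upper derivative gives a linear bound on increments near the point. -/
lemma eventually_dist_le_mul_of_limsup_lt {X Y : Type*} [MetricSpace X] [MetricSpace Y]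
    {f : X → Y} {x : X} {r : ℝ}
    (h : Filter.limsup (fun y => ((dist (f x) (f y) / dist x y : ℝ) : EReal)) (𝓝[≠] x)
      < (r : EReal)) :
    ∀ᶠ y in 𝓝 x, dist (f x) (f y) ≤ r * dist x y := by
  have h' := eventually_nhdsWithin_iff.1 (Filter.eventually_lt_of_limsup_lt h)
  filter_upwards [h'] with y hy
  rcases eq_or_ne y x with rfl | hne
  · simp
  · exact ((div_lt_iff₀ (dist_pos.2 hne.symm)).1 (EReal.coe_lt_coe_iff.1 (hy hne))).le

lemma continuousAt_of_eventually_dist_le_mul {X Y : Type*} [MetricSpace X] [MetricSpace Y]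
    {f : X → Y} {x : X} {r : ℝ} (h : ∀ᶠ y in 𝓝 x, dist (f x) (f y) ≤ r * dist x y) :
    ContinuousAt f x := by
  rw [ContinuousAt, tendsto_iff_dist_tendsto_zero]
  have hlim : Tendsto (fun y => r * dist x y) (𝓝 x) (𝓝 0) := by
    have : Continuous fun y => r * dist x y := by fun_prop
    simpa using this.tendsto x
  refine squeeze_zero' (Eventually.of_forall fun _ => dist_nonneg) ?_ hlim
  filter_upwards [h] with y hy
  rwa [dist_comm]

/-- Along a curve that does not increase distances, the increment of `f` is bounded by the
integral of any continuous function that dominates its upper derivative. -/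
lemma dist_le_integral_of_limsup_le {X Y : Type*} [MetricSpace X] [MetricSpace Y]
    {f : X → Y} {u : X → ℝ} (hu : Continuous u) (hu0 : ∀ x, 0 ≤ u x)
    (hf : ∀ x : X,
      Filter.limsup (fun y => ((dist (f x) (f y) / dist x y : ℝ) : EReal)) (𝓝[≠] x)
        ≤ (u x : EReal))
    {L : ℝ} (hL : 0 ≤ L) {γ : ℝ → X}
    (hγ : ∀ s t : ℝ, 0 ≤ s → s ≤ t → t ≤ L → dist (γ s) (γ t) ≤ t - s) :
    dist (f (γ 0)) (f (γ L)) ≤ ∫ s in (0:ℝ)..L, u (γ s) := by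
  have hloc : ∀ x r, u x < r → ∀ᶠ y in 𝓝 x, dist (f x) (f y) ≤ r * dist x y := fun x r hr =>
    eventually_dist_le_mul_of_limsup_lt ((hf x).trans_lt (EReal.coe_lt_coe_iff.2 hr))
  have hfc : Continuous f := continuous_iff_continuousAt.2 fun x =>
    continuousAt_of_eventually_dist_le_mul (hloc x (u x + 1) (lt_add_one _))
  have hγc : ContinuousOn γ (Set.Icc 0 L) := by
    refine LipschitzOnWith.continuousOn (K := 1) (LipschitzOnWith.of_dist_le_mul ?_)
    intro s hs t ht
    rw [NNReal.coe_one, one_mul, Real.dist_eq]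
    rcases le_total s t with hst | hst
    · rw [abs_sub_comm, abs_of_nonneg (sub_nonneg.2 hst)]
      exact hγ s t hs.1 hst ht.2
    · rw [dist_comm, abs_of_nonneg (sub_nonneg.2 hst)]
      exact hγ t s ht.1 hst hs.2
  set v : ℝ → ℝ := Set.IccExtend hL ((Set.Icc 0 L).domRestrict fun s => u (γ s)) with hv
  have hvc : Continuous v :=
    (continuousOn_iff_continuous_domRestrict.1 (hu.comp_continuousOn hγc)).Icc_extend'
  have hveq : ∀ s ∈ Set.Icc 0 L, v s = u (γ s) := fun s hs => by
    rw [hv, Set.IccExtend_of_mem hL _ hs]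
    rfl
  have hint : ∫ s in (0:ℝ)..L, v s = ∫ s in (0:ℝ)..L, u (γ s) :=
    intervalIntegral.integral_congr fun s hs => hveq s (by rwa [Set.uIcc_of_le hL] at hs)
  have hderiv : ∀ t, HasDerivAt (fun t => ∫ s in (0:ℝ)..t, v s) (v t) t := fun t =>
    (hvc.integral_hasStrictDerivAt 0 t).hasDerivAt
  rw [← hint]
  refine image_le_of_liminf_slope_right_le_deriv_boundary
    (f := fun t => dist (f (γ 0)) (f (γ t))) (B := fun t => ∫ s in (0:ℝ)..t, v s) (B' := v)
    ((continuous_const.dist hfc).comp_continuousOn hγc) (by simp)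
    (fun t _ => (hderiv t).continuousAt.continuousWithinAt)
    (fun t _ => (hderiv t).hasDerivWithinAt) ?_ (Set.right_mem_Icc.2 hL)
  intro t ht r hr
  rw [hveq t ⟨ht.1, ht.2.le⟩] at hr
  obtain ⟨q, hq, hqr⟩ := exists_between hr
  have hIoo : Set.Ioo t L ∈ 𝓝[>] t := Ioo_mem_nhdsGT ht.2
  have hγt : Tendsto γ (𝓝[>] t) (𝓝 (γ t)) := by
    refine (hγc t ⟨ht.1, ht.2.le⟩).mono_left ?_
    refine le_inf inf_le_left (le_principal_iff.2 (mem_of_superset hIoo ?_))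
    exact fun z hz => ⟨ht.1.trans hz.1.le, hz.2.le⟩
  refine Eventually.frequently ?_
  filter_upwards [hγt.eventually (hloc (γ t) q hq), hIoo] with z hz hzm
  have hpos : 0 < z - t := sub_pos.2 hzm.1
  rw [slope_def_field, div_lt_iff₀ hpos]
  calc dist (f (γ 0)) (f (γ z)) - dist (f (γ 0)) (f (γ t))
      ≤ dist (f (γ t)) (f (γ z)) := by
        linarith [dist_triangle (f (γ 0)) (f (γ t)) (f (γ z))]
    _ ≤ q * dist (γ t) (γ z) := hz
    _ ≤ q * (z - t) :=
        mul_le_mul_of_nonneg_left (hγ t z ht.1 hzm.1.le hzm.2.le) ((hu0 _).trans hq.le)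
    _ < r * (z - t) := mul_lt_mul_of_pos_right hqr hpos

/-- Hardy–Littlewood type theorem for mappings between metric spaces: if along curves
parametrized by arc length the weighted length is controlled by `M · φ(d_X(x,y))`, and the
upper derivative of `f` is bounded by `C · w`, then `f` is `φ`-Lipschitz with constant `M·C`.
Here `φ` is a majorant: continuous on `[0,∞)`, `φ(0) = 0`, strictly positive and increasing
on `(0,∞)`, differentiable on `(0,∞)` with decreasing derivative. -/
theorem stmt7 {X Y : Type*} [MetricSpace X] [MetricSpace Y]
    (w : X → ℝ) (hw : Continuous w) (hwpos : ∀ x, 0 < w x)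
    (φ φ' : ℝ → ℝ)
    (hφc : ContinuousOn φ (Set.Ici 0)) (hφ0 : φ 0 = 0)
    (hφpos : ∀ t : ℝ, 0 < t → 0 < φ t)
    (hφmono : MonotoneOn φ (Set.Ioi 0))
    (hφdiff : ∀ t : ℝ, 0 < t → HasDerivAt φ (φ' t) t)
    (hφ'anti : AntitoneOn φ' (Set.Ioi 0))
    (M C : ℝ) (hM : 0 ≤ M) (hC : 0 ≤ C)
    (hcurve : ∀ x y : X, ∃ L : ℝ, 0 ≤ L ∧ ∃ γ : ℝ → X,
      γ 0 = x ∧ γ L = y ∧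
      (∀ s t : ℝ, 0 ≤ s → s ≤ t → t ≤ L →
        eVariationOn γ (Set.Icc s t) = ENNReal.ofReal (t - s)) ∧
      ∫ s in (0:ℝ)..L, w (γ s) ≤ M * φ (dist x y))
    (f : X → Y)
    (hf : ∀ x : X,
      Filter.limsup (fun y => ((dist (f x) (f y) / dist x y : ℝ) : EReal)) (𝓝[≠] x)
        ≤ ((C * w x : ℝ) : EReal)) :
    ∀ x y : X, dist (f x) (f y) ≤ M * C * φ (dist x y) := by
  intro x y
  obtain ⟨L, hL, γ, rfl, rfl, hvar, hint⟩ := hcurve x y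
  have hγ : ∀ s t : ℝ, 0 ≤ s → s ≤ t → t ≤ L → dist (γ s) (γ t) ≤ t - s := by
    intro s t hs hst ht
    have h := eVariationOn.edist_le γ (Set.left_mem_Icc.2 hst) (Set.right_mem_Icc.2 hst)
    rwa [hvar s t hs hst ht, edist_le_ofReal (sub_nonneg.2 hst)] at h
  calc dist (f (γ 0)) (f (γ L)) ≤ ∫ s in (0:ℝ)..L, C * w (γ s) :=
        dist_le_integral_of_limsup_le (u := fun x => C * w x) (by fun_prop)
          (fun x => mul_nonneg hC (hwpos x).le) hf hL hγ
    _ = C * ∫ s in (0:ℝ)..L, w (γ s) := intervalIntegral.integral_const_mul _ _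
    _ ≤ C * (M * φ (dist (γ 0) (γ L))) := mul_le_mul_of_nonneg_left hint hC
    _ = M * C * φ (dist (γ 0) (γ L)) := by ring
end

section
/- Let (X, d_X) and (Y, d_Y) be metric spaces, w : X → (0, ∞) a continuous function, A > 0 and K, C ≥ 0 constants, and let φ : [0, ∞) → [0, ∞) be continuously differentiable on (0, ∞) with φ(t) ≤ A·t·φ'(t) for every t > 0. Let f : X → Y be bounded on every ball B(x, r) with x ∈ X and 0 < r < w(x), and suppose d*f(x) ≤ (K/r)·sup_{y ∈ B(x, r)} d_Y(f(x), f(y)) for every x ∈ X and every 0 < r < w(x). If d_Y(f(x), f(y)) ≤ C·φ(d_X(x, y)) for all x, y ∈ X, then d*f(x) ≤ A·K·C·φ'(w(x)) for every x ∈ X. -/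
open Filter Topology

open Set in
/-- If `ψ t ≤ A * t * ψ' t` on `(0, ∞)`, then `t ↦ ψ t * t ^ (-1 / A)` is nondecreasing there. -/
theorem monotoneOn_mul_rpow_of_le_mul_deriv {A : ℝ} (hA : 0 < A) {ψ ψ' : ℝ → ℝ}
    (hψ : ∀ t : ℝ, 0 < t → HasDerivAt ψ (ψ' t) t)
    (hψA : ∀ t : ℝ, 0 < t → ψ t ≤ A * t * ψ' t) :
    MonotoneOn (fun t => ψ t * t ^ (-1 / A)) (Ioi 0) := by
  have hd : ∀ t : ℝ, 0 < t → HasDerivAt (fun t => ψ t * t ^ (-1 / A))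
      (ψ' t * t ^ (-1 / A) + ψ t * (-1 / A * t ^ (-1 / A - 1))) t := fun t ht =>
    (hψ t ht).mul (Real.hasDerivAt_rpow_const (Or.inl ht.ne'))
  refine monotoneOn_of_deriv_nonneg (convex_Ioi 0)
    (fun t ht => (hd t ht).continuousAt.continuousWithinAt) ?_ ?_
  · rw [interior_Ioi]
    exact fun t ht => (hd t ht).differentiableAt.differentiableWithinAt
  · rw [interior_Ioi]
    intro t ht
    have ht : 0 < t := ht
    rw [(hd t ht).deriv, Real.rpow_sub_one ht.ne']
    have h : ψ' t * t ^ (-1 / A) + ψ t * (-1 / A * (t ^ (-1 / A) / t))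
        = t ^ (-1 / A) * (A * t * ψ' t - ψ t) / (A * t) := by
      field_simp
      ring
    rw [h]
    have := sub_nonneg.2 (hψA t ht)
    positivity

open Set in
/-- If `ψ t ≤ A * t * ψ' t` on `(0, ∞)` and `ψ` takes nonnegative values at arbitrarily small
arguments, then `ψ` is nonnegative on `(0, ∞)`. -/
theorem nonneg_of_le_mul_deriv {A : ℝ} (hA : 0 < A) {ψ ψ' : ℝ → ℝ}
    (hψ : ∀ t : ℝ, 0 < t → HasDerivAt ψ (ψ' t) t)
    (hψA : ∀ t : ℝ, 0 < t → ψ t ≤ A * t * ψ' t)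
    (hsmall : ∀ ε : ℝ, 0 < ε → ∃ s, 0 < s ∧ s < ε ∧ 0 ≤ ψ s) {t : ℝ} (ht : 0 < t) :
    0 ≤ ψ t := by
  obtain ⟨s, hs, hst, hψs⟩ := hsmall t ht
  have h := monotoneOn_mul_rpow_of_le_mul_deriv hA hψ hψA (mem_Ioi.2 hs) (mem_Ioi.2 ht) hst.le
  exact nonneg_of_mul_nonneg_left ((mul_nonneg hψs (by positivity)).trans h) (by positivity)

open Set in
/-- If `0 ≤ ψ t ≤ A * t * ψ' t` on `(0, ∞)`, then `ψ` is nondecreasing there. -/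
theorem monotoneOn_of_nonneg_of_le_mul_deriv {A : ℝ} (hA : 0 < A) {ψ ψ' : ℝ → ℝ}
    (hψ : ∀ t : ℝ, 0 < t → HasDerivAt ψ (ψ' t) t)
    (hψA : ∀ t : ℝ, 0 < t → ψ t ≤ A * t * ψ' t) (hψ0 : ∀ t : ℝ, 0 < t → 0 ≤ ψ t) :
    MonotoneOn ψ (Ioi 0) := by
  refine monotoneOn_of_deriv_nonneg (convex_Ioi 0)
    (fun t ht => (hψ t ht).continuousAt.continuousWithinAt) ?_ ?_
  · rw [interior_Ioi]
    exact fun t ht => (hψ t ht).differentiableAt.differentiableWithinAt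
  · rw [interior_Ioi]
    intro t ht
    have ht : 0 < t := ht
    rw [(hψ t ht).deriv]
    exact nonneg_of_mul_nonneg_right ((hψ0 t ht).trans (hψA t ht)) (by positivity)

/-- Converse Hardy–Littlewood type theorem: if `f` is regularly oscillating with constant `K`
with respect to the weight `w`, and `f` is `φ`-Lipschitz with constant `C`, where
`φ(t) ≤ A·t·φ'(t)` on `(0,∞)`, then the upper derivative of `f` satisfies
`d*f(x) ≤ A·K·C·φ'(w(x))`. -/
theorem stmt8 {X Y : Type*} [MetricSpace X] [MetricSpace Y]
    (w : X → ℝ) (hw : Continuous w) (hwpos : ∀ x, 0 < w x)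
    (A K C : ℝ) (hA : 0 < A) (hK : 0 ≤ K) (hC : 0 ≤ C)
    (φ φ' : ℝ → ℝ)
    (hφdiff : ∀ t : ℝ, 0 < t → HasDerivAt φ (φ' t) t)
    (hφ'cont : ContinuousOn φ' (Set.Ioi 0))
    (hφA : ∀ t : ℝ, 0 < t → φ t ≤ A * t * φ' t)
    (f : X → Y)
    (hbd : ∀ x : X, ∀ r : ℝ, 0 < r → r < w x →
      Bornology.IsBounded (f '' Metric.ball x r))
    (hreg : ∀ x : X, ∀ r : ℝ, 0 < r → r < w x →
      Filter.limsup (fun y => ((dist (f x) (f y) / dist x y : ℝ) : EReal)) (𝓝[≠] x)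
        ≤ (((K / r) * sSup ((fun y => dist (f x) (f y)) '' Metric.ball x r) : ℝ) : EReal))
    (hlip : ∀ x y : X, dist (f x) (f y) ≤ C * φ (dist x y)) :
    ∀ x : X,
      Filter.limsup (fun y => ((dist (f x) (f y) / dist x y : ℝ) : EReal)) (𝓝[≠] x)
        ≤ ((A * K * C * φ' (w x) : ℝ) : EReal) := by
  intro x
  rcases (𝓝[≠] x).eq_or_neBot with hx | hx
  · simp [hx]
  have hψ : ∀ t : ℝ, 0 < t → HasDerivAt (fun t => C * φ t) (C * φ' t) t :=
    fun t ht => (hφdiff t ht).const_mul C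
  have hψA : ∀ t : ℝ, 0 < t → C * φ t ≤ A * t * (C * φ' t) := fun t ht =>
    (mul_le_mul_of_nonneg_left (hφA t ht) hC).trans_eq (by ring)
  have hψ0 : ∀ t : ℝ, 0 < t → 0 ≤ C * φ t := fun t ht => by
    refine nonneg_of_le_mul_deriv hA hψ hψA (fun ε hε => ?_) ht
    obtain ⟨y, hy, hyx⟩ := hx.nonempty_of_mem (inter_mem
      (mem_nhdsWithin_of_mem_nhds (Metric.ball_mem_nhds x hε)) self_mem_nhdsWithin)
    exact ⟨dist x y, dist_pos.2 (Ne.symm hyx), Metric.mem_ball'.1 hy,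
      dist_nonneg.trans (hlip x y)⟩
  have hmono := monotoneOn_of_nonneg_of_le_mul_deriv hA hψ hψA hψ0
  have hcont : ContinuousAt φ' (w x) := hφ'cont.continuousAt (Ioi_mem_nhds (hwpos x))
  have htend : Tendsto (fun r => ((A * K * C * φ' r : ℝ) : EReal)) (𝓝[<] (w x))
      (𝓝 ((A * K * C * φ' (w x) : ℝ) : EReal)) :=
    (continuous_coe_real_ereal.tendsto _).comp
      ((hcont.tendsto.mono_left nhdsWithin_le_nhds).const_mul _)
  refine ge_of_tendsto htend ?_
  filter_upwards [Ioo_mem_nhdsLT (hwpos x)] with r hr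
  refine (hreg x r hr.1 hr.2).trans (EReal.coe_le_coe_iff.2 ?_)
  have hsup : sSup ((fun y => dist (f x) (f y)) '' Metric.ball x r) ≤ C * φ r := by
    refine csSup_le ((Metric.nonempty_ball.2 hr.1).image _) ?_
    rintro _ ⟨y, hy, rfl⟩
    rcases eq_or_ne x y with rfl | hxy
    · simpa using hψ0 r hr.1
    · exact (hlip x y).trans
        (hmono (dist_pos.2 hxy) hr.1 (Metric.mem_ball'.1 hy).le)
  have hr0 : 0 < r := hr.1
  calc K / r * sSup ((fun y => dist (f x) (f y)) '' Metric.ball x r)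
      ≤ K / r * (A * r * (C * φ' r)) := by
        gcongr
        exact hsup.trans (hψA r hr0)
    _ = A * K * C * φ' r := by field_simp
end

section
/- Let D be a domain (nonempty open connected set) with nonempty boundary in a real normed space X, let c > 0, α ∈ (0, 1), and x, y ∈ D. If γ : [0, L] → D is a curve parametrized by arc length with γ(0) = x, γ(L) = y, L ≤ c·‖x − y‖, and min(s, L − s) ≤ c·dist(γ(s), ∂D) for every s ∈ [0, L], then ∫_0^L dist(γ(s), ∂D)^{α−1} ds ≤ (2c/α)·‖x − y‖^α. -/
/-- If `d s ≥ min s (L - s) / c`, then negative powers of `d` are controlled by the sum of the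
corresponding powers of the distances to the two endpoints. -/
lemma rpow_sub_one_le_of_min_le {L c α s d : ℝ} (hc : 0 < c) (hα : α < 1)
    (hs : s ∈ Set.Ioo 0 L) (hd : min s (L - s) ≤ c * d) :
    d ^ (α - 1) ≤ c ^ (1 - α) * (s ^ (α - 1) + (L - s) ^ (α - 1)) := by
  have hs0 : 0 < s := hs.1
  have hsL : 0 < L - s := sub_pos.2 hs.2
  have hm : 0 < min s (L - s) := lt_min hs0 hsL
  have hle : min s (L - s) / c ≤ d := by rwa [div_le_iff₀' hc]
  calc
    d ^ (α - 1) ≤ (min s (L - s) / c) ^ (α - 1) :=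
      Real.rpow_le_rpow_of_nonpos (div_pos hm hc) hle (by linarith)
    _ = c ^ (1 - α) * min s (L - s) ^ (α - 1) := by
      rw [Real.div_rpow hm.le hc.le, ← neg_sub 1 α, Real.rpow_neg hc.le, div_inv_eq_mul, mul_comm]
    _ ≤ c ^ (1 - α) * (s ^ (α - 1) + (L - s) ^ (α - 1)) := by
      gcongr
      rcases min_choice s (L - s) with h | h <;> rw [h]
      · exact le_add_of_nonneg_right (Real.rpow_nonneg hsL.le _)
      · exact le_add_of_nonneg_left (Real.rpow_nonneg hs0.le _)

/-- The integral over `[0, L]` of a negative power of the distance to `A` along `γ` is controlled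
when this distance dominates the parameter distance to the endpoints. -/
lemma intervalIntegral_infDist_rpow_le {X : Type*} [PseudoMetricSpace X]
    {L c α r : ℝ} {γ : ℝ → X} {A : Set X} (hL : 0 ≤ L) (hc : 0 < c) (hα0 : 0 < α) (hα1 : α < 1) (hlen : L ≤ c * r)
    (h : ∀ s ∈ Set.Ioo 0 L, min s (L - s) ≤ c * Metric.infDist (γ s) A) :
    ∫ s in (0 : ℝ)..L, Metric.infDist (γ s) A ^ (α - 1) ≤ 2 * c / α * r ^ α := by
  have hr : 0 ≤ r := nonneg_of_mul_nonneg_right (hL.trans hlen) hc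
  have hint : IntervalIntegrable (fun s : ℝ => s ^ (α - 1)) MeasureTheory.volume 0 L :=
    intervalIntegral.intervalIntegrable_rpow' (by linarith)
  have hint' : IntervalIntegrable (fun s : ℝ => (L - s) ^ (α - 1)) MeasureTheory.volume 0 L := by
    simpa using (hint.comp_sub_left L).symm
  have hval : ∫ s in (0 : ℝ)..L, s ^ (α - 1) = L ^ α / α := by
    rw [integral_rpow (Or.inl (by linarith)), sub_add_cancel, Real.zero_rpow hα0.ne', sub_zero]
  have hval' : ∫ s in (0 : ℝ)..L, (L - s) ^ (α - 1) = L ^ α / α := by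
    rw [intervalIntegral.integral_comp_sub_left (fun s : ℝ => s ^ (α - 1)), sub_self, sub_zero,
      hval]
  calc
    ∫ s in (0 : ℝ)..L, Metric.infDist (γ s) A ^ (α - 1)
        ≤ ∫ s in (0 : ℝ)..L, c ^ (1 - α) * (s ^ (α - 1) + (L - s) ^ (α - 1)) := by
      have hg := ((hint.add hint').const_mul (c ^ (1 - α))).1
      rw [intervalIntegral.integral_of_le hL, intervalIntegral.integral_of_le hL,
        MeasureTheory.integral_Ioc_eq_integral_Ioo, MeasureTheory.integral_Ioc_eq_integral_Ioo]
      refine MeasureTheory.integral_mono_of_nonneg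
        (Filter.Eventually.of_forall fun s => Real.rpow_nonneg Metric.infDist_nonneg _)
        (hg.mono_set Set.Ioo_subset_Ioc_self) ?_
      filter_upwards [MeasureTheory.ae_restrict_mem measurableSet_Ioo] with s hs
      exact rpow_sub_one_le_of_min_le hc hα1 hs (h s hs)
    _ = c ^ (1 - α) * (2 / α) * L ^ α := by
      rw [intervalIntegral.integral_const_mul, intervalIntegral.integral_add hint hint', hval,
        hval']
      ring
    _ ≤ c ^ (1 - α) * (2 / α) * (c * r) ^ α := by gcongr
    _ = 2 * c / α * r ^ α := by
      have hcc : c ^ (1 - α) * c ^ α = c := by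
        rw [← Real.rpow_add hc, sub_add_cancel, Real.rpow_one]
      rw [Real.mul_rpow hc.le hr]
      linear_combination 2 / α * r ^ α * hcc


/-- A uniform-type arc in a domain `D` with nonempty boundary in a real normed space
satisfies the integral estimate
`∫₀ᴸ dist(γ(s), ∂D)^(α-1) ds ≤ (2c/α)·‖x - y‖^α`. -/
theorem stmt9 {X : Type*} [NormedAddCommGroup X] [NormedSpace ℝ X]
    (D : Set X) (hD : IsOpen D) (hDconn : IsConnected D)
    (hfr : (frontier D).Nonempty)
    (c : ℝ) (hc : 0 < c) (α : ℝ) (hα : α ∈ Set.Ioo (0 : ℝ) 1)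
    (x y : X) (hx : x ∈ D) (hy : y ∈ D)
    (L : ℝ) (hL : 0 ≤ L) (γ : ℝ → X)
    (hγD : ∀ s ∈ Set.Icc (0 : ℝ) L, γ s ∈ D)
    (hγ0 : γ 0 = x) (hγL : γ L = y)
    (harc : ∀ s t : ℝ, 0 ≤ s → s ≤ t → t ≤ L →
      eVariationOn γ (Set.Icc s t) = ENNReal.ofReal (t - s))
    (hlen : L ≤ c * ‖x - y‖)
    (hcig : ∀ s ∈ Set.Icc (0 : ℝ) L,
      min s (L - s) ≤ c * Metric.infDist (γ s) (frontier D)) :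
    ∫ s in (0:ℝ)..L, Metric.infDist (γ s) (frontier D) ^ (α - 1)
      ≤ (2 * c / α) * ‖x - y‖ ^ α := by
  obtain ⟨hα0, hα1⟩ := hα
  exact intervalIntegral_infDist_rpow_le hL hc hα0 hα1 hlen fun s hs =>
    hcig s (Set.Ioo_subset_Icc_self hs)
end

section
/- (Hardy–Littlewood theorem on uniform domains, forward direction) Let α ∈ (0, 1), let D be a c-uniform domain in a complex normed space X, let Y be a complex normed space, and let f : D → Y be analytic with ‖df(z)‖ ≤ C·dist(z, ∂D)^{α−1} for every z ∈ D, where C ≥ 0 is a constant. Then ‖f(z) − f(w)‖ ≤ (2c/α)·C·‖z − w‖^α for all z, w ∈ D. -/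
open scoped Topology in
/-- Along a path of speed at most one whose distance to the boundary grows at least linearly, the
increments of `f` are controlled by the bound `C * infDist ^ (α - 1)` on its differential. -/
theorem norm_sub_le_of_infDist_growth {X Y : Type*} [NormedAddCommGroup X] [NormedSpace ℂ X]
    [NormedAddCommGroup Y] [NormedSpace ℂ Y] {α c C l : ℝ} (hα : α ∈ Set.Ioo (0 : ℝ) 1)
    (hc : 0 < c) (hC : 0 ≤ C) (hl : 0 ≤ l) {D E : Set X} {f : X → Y} {df : X → X →L[ℂ] Y}
    (hf : ∀ z ∈ D, HasFDerivAt f (df z) z)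
    (hder : ∀ z ∈ D, ‖df z‖ ≤ C * Metric.infDist z E ^ (α - 1))
    {γ : ℝ → X} (hγD : ∀ s ∈ Set.Icc 0 l, γ s ∈ D)
    (hγ : LipschitzOnWith 1 γ (Set.Icc 0 l))
    (hdist : ∀ s ∈ Set.Icc 0 l, s ≤ c * Metric.infDist (γ s) E) :
    ‖f (γ l) - f (γ 0)‖ ≤ C * c / α * (l / c) ^ α := by
  obtain ⟨hα0, hα1⟩ := hα
  rcases hl.eq_or_lt with rfl | hl
  · simp [hα0.ne']
  have hcont : ContinuousOn (fun s => f (γ s)) (Set.Icc 0 l) := fun s hs =>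
    (hf _ (hγD s hs)).continuousAt.comp_continuousWithinAt (hγ.continuousOn s hs)
  have hinner : ∀ a ∈ Set.Ioc 0 l, ‖f (γ l) - f (γ a)‖ ≤ C * c / α * (l / c) ^ α := by
    rintro a ⟨ha, hal⟩
    have hsub : Set.Icc a l ⊆ Set.Icc 0 l := Set.Icc_subset_Icc_left ha.le
    have hB : ∀ s : ℝ, 0 < s →
        HasDerivAt (fun s => C * c / α * (s / c) ^ α) (C * (s / c) ^ (α - 1)) s := by
      intro s hs
      have h := (((hasDerivAt_id s).div_const c).rpow_const (p := α)
        (Or.inl (div_pos hs hc).ne')).const_mul (C * c / α)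
      refine h.congr_deriv ?_
      simp only [id]
      field_simp
    refine image_le_of_liminf_slope_right_le_deriv_boundary
      (f := fun s => ‖f (γ s) - f (γ a)‖) (a := a) (b := l)
      (B := fun s => C * c / α * (s / c) ^ α) (B' := fun s => C * (s / c) ^ (α - 1))
      ((hcont.mono hsub).sub continuousOn_const).norm ?_ ?_ ?_ ?_ (Set.right_mem_Icc.2 hal)
    · simp only [sub_self, norm_zero]
      positivity
    · exact fun s hs => (hB s (ha.trans_le hs.1)).continuousAt.continuousWithinAt
    · exact fun s hs => (hB s (ha.trans_le hs.1)).hasDerivWithinAt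
    · intro s hs r hr
      have hs0 : 0 < s := ha.trans_le hs.1
      have hsl : s ∈ Set.Icc 0 l := ⟨hs0.le, hs.2.le⟩
      obtain ⟨K, hK, hKr⟩ := exists_between hr
      have hdf : ‖df (γ s)‖ < K := by
        refine ((hder _ (hγD s hsl)).trans (mul_le_mul_of_nonneg_left ?_ hC)).trans_lt hK
        refine Real.rpow_le_rpow_of_nonpos (div_pos hs0 hc) ?_ (by linarith)
        rw [div_le_iff₀' hc]
        exact hdist s hsl
      have hnear := (hf _ (hγD s hsl)).isLittleO.def (sub_pos.2 hdf)
      have hmem : Set.Icc 0 l ∈ 𝓝[>] s :=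
        Filter.mem_of_superset (Ioo_mem_nhdsGT hs.2)
          fun t ht => ⟨hs0.le.trans ht.1.le, ht.2.le⟩
      have htends : Filter.Tendsto γ (𝓝[>] s) (𝓝 (γ s)) :=
        (hγ.continuousOn s hsl).mono_left (nhdsWithin_le_iff.2 hmem)
      refine Filter.Eventually.frequently ?_
      filter_upwards [htends.eventually hnear, hmem, self_mem_nhdsWithin] with t ht htl hst
      have hst : s < t := hst
      have hlip : ‖γ t - γ s‖ ≤ t - s := by
        have h := hγ.dist_le_mul t htl s hsl
        rwa [NNReal.coe_one, one_mul, dist_eq_norm, Real.dist_eq,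
          abs_of_pos (sub_pos.2 hst)] at h
      have hinc : ‖f (γ t) - f (γ s)‖ ≤ K * (t - s) := by
        have h₁ : ‖f (γ t) - f (γ s)‖ ≤ K * ‖γ t - γ s‖ := by
          have h₂ := norm_le_norm_sub_add (f (γ t) - f (γ s)) (df (γ s) (γ t - γ s))
          have h₃ := (df (γ s)).le_opNorm (γ t - γ s)
          linarith
        exact h₁.trans (mul_le_mul_of_nonneg_left hlip ((norm_nonneg _).trans hdf.le))
      have htri := norm_sub_norm_le (f (γ t) - f (γ a)) (f (γ s) - f (γ a))
      rw [sub_sub_sub_cancel_right] at htri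
      refine lt_of_le_of_lt ?_ hKr
      rw [slope_def_field, div_le_iff₀ (sub_pos.2 hst)]
      exact htri.trans hinc
  have hlim : Filter.Tendsto (fun a => ‖f (γ l) - f (γ a)‖) (𝓝[>] 0)
      (𝓝 ‖f (γ l) - f (γ 0)‖) := by
    have h := (hcont 0 (Set.left_mem_Icc.2 hl.le)).mono_left
      (nhdsWithin_le_iff.2 (Icc_mem_nhdsGT hl))
    exact (tendsto_const_nhds.sub h).norm
  exact le_of_tendsto hlim (Filter.eventually_of_mem (Ioc_mem_nhdsGT hl) hinner)


/-- Hardy–Littlewood theorem on uniform domains, forward direction: an analytic mapping on a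
`c`-uniform domain in a complex normed space whose differential satisfies
`‖df(z)‖ ≤ C·dist(z,∂D)^(α-1)` is `α`-Hölder continuous with constant `(2c/α)·C`. -/
theorem stmt10 {X Y : Type*} [NormedAddCommGroup X] [NormedSpace ℂ X]
    [NormedAddCommGroup Y] [NormedSpace ℂ Y]
    (α : ℝ) (hα : α ∈ Set.Ioo (0 : ℝ) 1) (c : ℝ) (hc : 0 < c)
    (D : Set X) (hD : IsOpen D) (hDconn : IsConnected D)
    (hfr : (frontier D).Nonempty)
    (huniform : ∀ x ∈ D, ∀ y ∈ D, ∃ L : ℝ, 0 ≤ L ∧ ∃ γ : ℝ → X,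
      (∀ s ∈ Set.Icc (0 : ℝ) L, γ s ∈ D) ∧
      Set.InjOn γ (Set.Icc (0 : ℝ) L) ∧
      (∀ s t : ℝ, 0 ≤ s → s ≤ t → t ≤ L →
        eVariationOn γ (Set.Icc s t) = ENNReal.ofReal (t - s)) ∧
      γ 0 = x ∧ γ L = y ∧ L ≤ c * ‖x - y‖ ∧
      ∀ s ∈ Set.Icc (0 : ℝ) L,
        min s (L - s) ≤ c * Metric.infDist (γ s) (frontier D))
    (f : X → Y) (df : X → X →L[ℂ] Y)
    (hf : ∀ z ∈ D, HasFDerivAt f (df z) z)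
    (C : ℝ) (hC : 0 ≤ C)
    (hder : ∀ z ∈ D, ‖df z‖ ≤ C * Metric.infDist z (frontier D) ^ (α - 1)) :
    ∀ z ∈ D, ∀ w ∈ D, ‖f z - f w‖ ≤ (2 * c / α) * C * ‖z - w‖ ^ α := by
  intro z hz w hw
  obtain ⟨L, hL, γ, hγD, -, hvar, rfl, rfl, hLc, hmin⟩ := huniform z hz w hw
  have hα0 := hα.1
  have hlip : LipschitzOnWith 1 γ (Set.Icc 0 L) := by
    have hle : ∀ s ∈ Set.Icc 0 L, ∀ t ∈ Set.Icc 0 L, s ≤ t →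
        edist (γ s) (γ t) ≤ edist s t := by
      intro s hs t ht hst
      refine (eVariationOn.edist_le γ (Set.left_mem_Icc.2 hst) (Set.right_mem_Icc.2 hst)).trans ?_
      rw [hvar s t hs.1 hst ht.2, edist_comm, edist_dist, Real.dist_eq,
        abs_of_nonneg (sub_nonneg.2 hst)]
    intro s hs t ht
    rw [ENNReal.coe_one, one_mul]
    rcases le_total s t with hst | hst
    · exact hle s hs t ht hst
    · rw [edist_comm, edist_comm s t]
      exact hle t ht s hs hst
  have hsub : Set.Icc 0 (L / 2) ⊆ Set.Icc 0 L := Set.Icc_subset_Icc_right (by linarith)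
  have hrefl : Set.MapsTo (fun s => L - s) (Set.Icc 0 (L / 2)) (Set.Icc 0 L) :=
    fun s hs => ⟨by linarith [hs.2], by linarith [hs.1]⟩
  have hhalf : 0 ≤ L / 2 := by linarith
  have hfirst := norm_sub_le_of_infDist_growth hα hc hC hhalf hf hder
    (fun s hs => hγD s (hsub hs)) (hlip.mono hsub) (fun s hs => by
      have h := hmin s (hsub hs)
      rwa [min_eq_left (by linarith [hs.2])] at h)
  have hsecond := norm_sub_le_of_infDist_growth (γ := fun s => γ (L - s)) hα hc hC hhalf hf hder
    (fun s hs => hγD _ (hrefl hs))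
    (fun s hs t ht => by
      have h := hlip (hrefl hs) (hrefl ht)
      rwa [edist_sub_left] at h)
    (fun s hs => by
      have h := hmin _ (hrefl hs)
      rwa [min_eq_right (by linarith [hs.2]), sub_sub_cancel] at h)
  simp only [sub_zero, sub_half] at hsecond
  have hpow : (L / 2 / c) ^ α ≤ ‖γ 0 - γ L‖ ^ α := by
    refine Real.rpow_le_rpow (by positivity) ?_ hα0.le
    rw [div_le_iff₀ hc]
    linarith
  have hscale := mul_le_mul_of_nonneg_left hpow (show 0 ≤ C * c / α by positivity)
  have htri := norm_sub_le_norm_sub_add_norm_sub (f (γ 0)) (f (γ (L / 2))) (f (γ L))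
  rw [norm_sub_rev (f (γ 0)) (f (γ (L / 2)))] at htri
  calc ‖f (γ 0) - f (γ L)‖ ≤ 2 * (C * c / α * ‖γ 0 - γ L‖ ^ α) := by linarith
    _ = 2 * c / α * C * ‖γ 0 - γ L‖ ^ α := by ring
end

section
/- (Hardy–Littlewood theorem, converse direction) Let α ∈ (0, 1), let D be a domain (nonempty open connected set) with nonempty boundary in a complex normed space X, let Y be a complex normed space, and let f : D → Y be analytic with ‖f(z) − f(w)‖ ≤ C·‖z − w‖^α for all z, w ∈ D, where C ≥ 0 is a constant. Then ‖df(z)‖ ≤ C·dist(z, ∂D)^{α−1} for every z ∈ D. -/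
/-- A preconnected set that meets an open set `D` but not its frontier is contained in `D`. -/
theorem IsPreconnected.subset_of_disjoint_frontier {T : Type*} [TopologicalSpace T] {s D : Set T}
    (hs : IsPreconnected s) (hD : IsOpen D) (hsD : (s ∩ D).Nonempty)
    (hd : Disjoint s (frontier D)) : s ⊆ D := by
  refine hs.subset_left_of_subset_union hD isClosed_closure.isOpen_compl
    (disjoint_compl_right.mono_left subset_closure) (fun x hx ↦ ?_) hsD
  by_contra h
  rw [Set.mem_union, not_or, Set.notMem_compl_iff] at h
  exact hd.notMem_of_mem_left hx (hD.frontier_eq ▸ ⟨h.2, h.1⟩)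


/-- Hardy–Littlewood theorem, converse direction: an `α`-Hölder continuous analytic mapping
with constant `C` on a domain `D` with nonempty boundary in a complex normed space satisfies
`‖df(z)‖ ≤ C·dist(z,∂D)^(α-1)` on `D`. -/
theorem stmt11 {X Y : Type*} [NormedAddCommGroup X] [NormedSpace ℂ X]
    [NormedAddCommGroup Y] [NormedSpace ℂ Y]
    (α : ℝ) (hα : α ∈ Set.Ioo (0 : ℝ) 1)
    (D : Set X) (hD : IsOpen D) (hDconn : IsConnected D)
    (hfr : (frontier D).Nonempty)
    (f : X → Y) (df : X → X →L[ℂ] Y)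
    (hf : ∀ z ∈ D, HasFDerivAt f (df z) z)
    (C : ℝ) (hC : 0 ≤ C)
    (hlip : ∀ z ∈ D, ∀ w ∈ D, ‖f z - f w‖ ≤ C * ‖z - w‖ ^ α) :
    ∀ z ∈ D, ‖df z‖ ≤ C * Metric.infDist z (frontier D) ^ (α - 1) := by
  intro z hz
  set d := Metric.infDist z (frontier D) with hd
  have hd0 : 0 < d := (isClosed_frontier.notMem_iff_infDist_pos hfr).1
    fun h ↦ (hD.frontier_eq ▸ h).2 hz
  let _ : NormedSpace ℝ X := NormedSpace.restrictScalars ℝ ℂ X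
  have hball : Metric.ball z d ⊆ D :=
    (convex_ball z d).isPreconnected.subset_of_disjoint_frontier hD
      ⟨z, Metric.mem_ball_self hd0, hz⟩ Metric.disjoint_ball_infDist
  have hdiff : DifferentiableOn ℂ f (Metric.ball z d) :=
    fun w hw ↦ (hf w (hball hw)).differentiableAt.differentiableWithinAt
  have hmaps : Set.MapsTo f (Metric.ball z d) (Metric.closedBall (f z) (C * d ^ α)) := by
    intro w hw
    rw [mem_closedBall_iff_norm]
    refine (hlip w (hball hw) z hz).trans ?_
    gcongr
    · exact hα.1.le
    · exact (mem_ball_iff_norm.1 hw).le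
  rw [← (hf z hz).fderiv, Real.rpow_sub_one hd0.ne', ← mul_div_assoc]
  exact Complex.norm_fderiv_le_div_of_mapsTo_ball hdiff hmaps hd0
end

section
/- Let (X, d_X) and (Y, d_Y) be metric spaces, w : X → (0, ∞) a continuous function, p ∈ [1, ∞), A ⊆ Y nonempty, and K ≥ 0. Assume f : X → Y is p-regular, i.e. d*f(x) ≤ (K/r)·sup_{y ∈ B(x, r)} |dist(f(x), A)^p − dist(f(y), A)^p|^{1/p} for every x ∈ X and every 0 < r < w(x). Let α > 0 and β = α/p, and suppose: (i) there is C ≥ 0 such that |dist(f(x), A)^p − dist(f(y), A)^p| ≤ C·d_X(x, y)^α whenever x ∈ X and y ∈ B(x, w(x)); (ii) there is M ≥ 0 such that for all x, y ∈ X there exist L ≥ 0 and a curve γ : [0, L] → X parametrized by arc length with γ(0) = x, γ(L) = y and ∫_0^L w(γ(s))^{β−1} ds ≤ M·d_X(x, y)^β. Then d_Y(f(x), f(y)) ≤ M·K·C^{1/p}·d_X(x, y)^{α/p} for all x, y ∈ X. -/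
open Filter Topology

/-- A map on the line with a pointwise upper derivative bound by a continuous function
satisfies the corresponding integral bound. -/
lemma dist_le_integral_of_eventually_dist_le {Y : Type*} [MetricSpace Y] {g : ℝ → Y}
    {h : ℝ → ℝ} (hh : Continuous h) {L : ℝ} (hL : 0 ≤ L)
    (hg : ∀ s c : ℝ, h s < c → ∀ᶠ t in 𝓝 s, dist (g s) (g t) ≤ c * |t - s|) :
    dist (g 0) (g L) ≤ ∫ s in (0:ℝ)..L, h s := by
  have hgc : Continuous g := by
    rw [continuous_iff_continuousAt]
    intro s
    rw [ContinuousAt, tendsto_iff_dist_tendsto_zero]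
    have hlim : Tendsto (fun t => (h s + 1) * |t - s|) (𝓝 s) (𝓝 0) := by
      have : Continuous fun t : ℝ => (h s + 1) * |t - s| := by fun_prop
      simpa using this.tendsto s
    refine squeeze_zero' (Eventually.of_forall fun _ => dist_nonneg) ?_ hlim
    filter_upwards [hg s (h s + 1) (by linarith)] with t ht
    rwa [dist_comm]
  have hderiv : ∀ x, HasDerivAt (fun t => ∫ s in (0:ℝ)..t, h s) (h x) x := fun x =>
    intervalIntegral.integral_hasDerivAt_right (hh.intervalIntegrable _ _)
      (hh.stronglyMeasurableAtFilter _ _) hh.continuousAt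
  refine image_le_of_liminf_slope_right_le_deriv_boundary (f := fun t => dist (g 0) (g t))
    (a := 0) (b := L) (B := fun t => ∫ s in (0:ℝ)..t, h s) (B' := h)
    (by fun_prop) (by simp)
    (fun x _ => (hderiv x).continuousAt.continuousWithinAt)
    (fun x _ => (hderiv x).hasDerivWithinAt) ?_ ⟨hL, le_rfl⟩
  intro x _ r hr
  obtain ⟨c, hc, hcr⟩ := exists_between hr
  apply Eventually.frequently
  filter_upwards [nhdsWithin_le_nhds (hg x c hc), self_mem_nhdsWithin] with z hz hxz
  have hpos : 0 < z - x := sub_pos.2 hxz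
  rw [slope_def_field, div_lt_iff₀ hpos]
  rw [abs_of_pos hpos] at hz
  have := dist_triangle (g 0) (g x) (g z)
  nlinarith

/-- A bound on the limit superior of the difference quotients at `x` gives a local
Lipschitz estimate at `x`. -/
lemma eventually_dist_le_of_limsup_lt {X Y : Type*} [MetricSpace X] [MetricSpace Y]
    {f : X → Y} {x : X} {c : ℝ}
    (h : Filter.limsup (fun y => ((dist (f x) (f y) / dist x y : ℝ) : EReal)) (𝓝[≠] x)
      < (c : EReal)) :
    ∀ᶠ y in 𝓝 x, dist (f x) (f y) ≤ c * dist x y := by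
  have h' := eventually_nhdsWithin_iff.1 (eventually_lt_of_limsup_lt h)
  filter_upwards [h'] with y hy
  rcases eq_or_ne y x with rfl | hne
  · simp
  · have := EReal.coe_lt_coe_iff.1 (hy hne)
    rw [div_lt_iff₀ (dist_pos.2 hne.symm)] at this
    exact this.le

/-- Main theorem: if `f` is `p`-regular with constant `K` with respect to the weight `w` and
the nonempty set `A ⊆ Y`, the function `dist(f(·), A)^p` is locally `α`-Lipschitz with respect
to `w`, and weighted curve lengths for the weight `w^(β-1)`, `β = α/p`, are controlled by
`M·d_X(x,y)^β`, then `f ∈ Λ^{α/p}` with norm at most `M·K·C^{1/p}`. -/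
theorem stmt12 {X Y : Type*} [MetricSpace X] [MetricSpace Y]
    (w : X → ℝ) (hw : Continuous w) (hwpos : ∀ x, 0 < w x)
    (p : ℝ) (hp : 1 ≤ p) (A : Set Y) (hA : A.Nonempty) (K : ℝ) (hK : 0 ≤ K)
    (f : X → Y)
    (hreg : ∀ x : X, ∀ r : ℝ, 0 < r → r < w x →
      Filter.limsup (fun y => ((dist (f x) (f y) / dist x y : ℝ) : EReal)) (𝓝[≠] x)
        ≤ (((K / r) * sSup ((fun y =>
              |Metric.infDist (f x) A ^ p - Metric.infDist (f y) A ^ p| ^ (1 / p))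
            '' Metric.ball x r) : ℝ) : EReal))
    (α : ℝ) (hα : 0 < α) (C : ℝ) (hC : 0 ≤ C)
    (hloc : ∀ x y : X, dist x y < w x →
      |Metric.infDist (f x) A ^ p - Metric.infDist (f y) A ^ p| ≤ C * dist x y ^ α)
    (M : ℝ) (hM : 0 ≤ M)
    (hcurve : ∀ x y : X, ∃ L : ℝ, 0 ≤ L ∧ ∃ γ : ℝ → X,
      γ 0 = x ∧ γ L = y ∧
      (∀ s t : ℝ, 0 ≤ s → s ≤ t → t ≤ L →
        eVariationOn γ (Set.Icc s t) = ENNReal.ofReal (t - s)) ∧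
      ∫ s in (0:ℝ)..L, w (γ s) ^ (α / p - 1) ≤ M * dist x y ^ (α / p)) :
    ∀ x y : X, dist (f x) (f y) ≤ M * K * C ^ (1 / p) * dist x y ^ (α / p) := by
  intro x y
  have hp0 : 0 < p := by linarith
  set D : ℝ := K * C ^ (1 / p) with hD
  have hD0 : 0 ≤ D := by positivity
  have hbound : ∀ (x : X) (r : ℝ), 0 < r → r < w x →
      Filter.limsup (fun y => ((dist (f x) (f y) / dist x y : ℝ) : EReal)) (𝓝[≠] x)
        ≤ ((D * r ^ (α / p - 1) : ℝ) : EReal) := by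
    intro x r hr hrw
    refine (hreg x r hr hrw).trans (EReal.coe_le_coe_iff.2 ?_)
    have hsup : sSup ((fun y =>
        |Metric.infDist (f x) A ^ p - Metric.infDist (f y) A ^ p| ^ (1 / p))
          '' Metric.ball x r) ≤ C ^ (1 / p) * r ^ (α / p) := by
      refine Real.sSup_le ?_ (by positivity)
      rintro _ ⟨z, hz, rfl⟩
      have hz' : dist x z < r := by rwa [Metric.mem_ball'] at hz
      calc |Metric.infDist (f x) A ^ p - Metric.infDist (f z) A ^ p| ^ (1 / p)
          ≤ (C * r ^ α) ^ (1 / p) := by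
            refine Real.rpow_le_rpow (abs_nonneg _)
              ((hloc x z (hz'.trans hrw)).trans ?_) (by positivity)
            gcongr
        _ = C ^ (1 / p) * r ^ (α / p) := by
            rw [Real.mul_rpow hC (by positivity), ← Real.rpow_mul hr.le, mul_one_div]
    calc K / r * _ ≤ K / r * (C ^ (1 / p) * r ^ (α / p)) := by gcongr
      _ = D * r ^ (α / p - 1) := by
        rw [Real.rpow_sub_one hr.ne', hD]
        ring
  have hlip : ∀ (x : X) (c : ℝ), D * w x ^ (α / p - 1) < c →
      ∀ᶠ y in 𝓝 x, dist (f x) (f y) ≤ c * dist x y := by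
    intro x c hc
    have hcont : ContinuousAt (fun r : ℝ => D * r ^ (α / p - 1)) (w x) :=
      continuousAt_const.mul (Real.continuousAt_rpow_const _ _ (Or.inl (hwpos x).ne'))
    have hev : ∀ᶠ r : ℝ in 𝓝[<] (w x), D * r ^ (α / p - 1) < c :=
      nhdsWithin_le_nhds (hcont.eventually_lt_const hc)
    obtain ⟨r, hrc, hrw, hr⟩ := (hev.and (eventually_mem_nhdsWithin.and
      (nhdsWithin_le_nhds (lt_mem_nhds (hwpos x))))).exists
    exact eventually_dist_le_of_limsup_lt
      ((hbound x r hr hrw).trans_lt (EReal.coe_lt_coe_iff.2 hrc))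
  obtain ⟨L, hL, γ, rfl, rfl, hvar, hint⟩ := hcurve x y
  have hγ : LipschitzWith 1 ((Set.Icc 0 L).domRestrict γ) := by
    rw [← lipschitzOnWith_iff_restrict]
    have key : ∀ s t : ℝ, 0 ≤ s → s ≤ t → t ≤ L → edist (γ s) (γ t) ≤ edist s t := by
      intro s t hs hst ht
      refine (eVariationOn.edist_le γ (Set.left_mem_Icc.2 hst)
        (Set.right_mem_Icc.2 hst)).trans ?_
      rw [hvar s t hs hst ht, edist_comm, edist_dist, Real.dist_eq,
        abs_of_nonneg (sub_nonneg.2 hst)]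
    intro s hs t ht
    rw [ENNReal.coe_one, one_mul]
    rcases le_total s t with hst | hts
    · exact key s t hs.1 hst ht.2
    · rw [edist_comm, edist_comm s]
      exact key t s ht.1 hts hs.2
  set Γ : ℝ → X := Set.IccExtend hL ((Set.Icc 0 L).domRestrict γ)
  have hΓ : LipschitzWith 1 Γ := by
    simpa [Γ, Set.IccExtend] using hγ.comp (LipschitzWith.projIcc hL)
  have hΓγ : ∀ s ∈ Set.Icc 0 L, Γ s = γ s := fun s hs => by
    simp [Γ, Set.IccExtend_of_mem hL _ hs]
  have hcontw : Continuous fun s => D * w (Γ s) ^ (α / p - 1) :=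
    continuous_const.mul ((hw.comp hΓ.continuous).rpow_const
      fun s => Or.inl (hwpos (Γ s)).ne')
  have hmain := dist_le_integral_of_eventually_dist_le (g := fun s => f (Γ s)) hcontw hL (by
    intro s c hc
    have hc0 : 0 ≤ c := (mul_nonneg hD0 (Real.rpow_nonneg (hwpos _).le _)).trans hc.le
    filter_upwards [hΓ.continuous.continuousAt.eventually (hlip (Γ s) c hc)] with t ht
    refine ht.trans (mul_le_mul_of_nonneg_left ?_ hc0)
    rw [dist_comm, ← Real.dist_eq]
    simpa using hΓ.dist_le_mul t s)
  rw [hΓγ 0 ⟨le_rfl, hL⟩, hΓγ L ⟨hL, le_rfl⟩, intervalIntegral.integral_const_mul] at hmain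
  have hcongr : ∫ s in (0:ℝ)..L, w (Γ s) ^ (α / p - 1)
      = ∫ s in (0:ℝ)..L, w (γ s) ^ (α / p - 1) := by
    refine intervalIntegral.integral_congr fun s hs => ?_
    rw [Set.uIcc_of_le hL] at hs
    simp only [hΓγ s hs]
  rw [hcongr] at hmain
  calc dist (f (γ 0)) (f (γ L)) ≤ D * ∫ s in (0:ℝ)..L, w (γ s) ^ (α / p - 1) := hmain
    _ ≤ D * (M * dist (γ 0) (γ L) ^ (α / p)) := by gcongr
    _ = M * K * C ^ (1 / p) * dist (γ 0) (γ L) ^ (α / p) := by rw [hD]; ring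
end

section
/- Let X be a complex normed space, Y a complex inner product space, D ⊆ X a domain (nonempty open connected set) with nonempty boundary, and f : D → Y a bounded analytic mapping. Then for every x ∈ D and every 0 < r < dist(x, ∂D), setting M = sup_{y ∈ B(x, r)} ‖f(y)‖, one has ‖df(x)‖ ≤ (1/r)·√(M² − ‖f(x)‖²); consequently ‖df(x)‖ ≤ (1/r)·sup_{y ∈ B(x, r)} |‖f(y)‖² − ‖f(x)‖²|^{1/2}, i.e. f is 2-regular with constant K = 1 with respect to the weight dist(·, ∂D) and the set A = {0}. -/
open Metric in
/-- If a function holomorphic on a disc has real part at most `C` on a smaller concentric circle,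
then its real part at the center is at most `C`. -/
theorem re_center_le_of_re_le_on_sphere {G : ℂ → ℂ} {c : ℂ} {r ρ C : ℝ} (hρ : 0 < ρ) (hρr : ρ < r)
    (hG : DifferentiableOn ℂ G (ball c r)) (hC : ∀ t ∈ sphere c ρ, (G t).re ≤ C) :
    (G c).re ≤ C := by
  have hd : DiffContOnCl ℂ (fun t => Complex.exp (G t)) (ball c ρ) := by
    refine DifferentiableOn.diffContOnCl ?_
    rw [closure_ball c hρ.ne']
    exact (hG.mono (closedBall_subset_ball hρr)).cexp
  have h := Complex.norm_le_of_forall_mem_frontier_norm_le isBounded_ball hd (C := Real.exp C)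
    (fun t ht => by
      rw [frontier_ball c hρ.ne'] at ht
      rw [Complex.norm_exp]
      exact Real.exp_le_exp.2 (hC t ht)) (subset_closure (mem_ball_self hρ))
  rw [Complex.norm_exp] at h
  exact Real.exp_le_exp.1 h

open Metric in
/-- The first two terms of the Parseval inequality for a bounded holomorphic function on a disc
with values in a (not necessarily complete) inner product space. -/
theorem sq_norm_add_sq_norm_deriv_le {Y : Type*} [NormedAddCommGroup Y] [InnerProductSpace ℂ Y]
    {φ : ℂ → Y} {r ρ M : ℝ} (hρ : 0 < ρ) (hρr : ρ < r)
    (hφ : DifferentiableOn ℂ φ (ball 0 r)) (hM : ∀ t ∈ ball (0 : ℂ) r, ‖φ t‖ ≤ M) :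
    ‖φ 0‖ ^ 2 + ρ ^ 2 * ‖deriv φ 0‖ ^ 2 ≤ M ^ 2 := by
  have h0 : (0 : ℂ) ∈ ball (0 : ℂ) r := mem_ball_self (hρ.trans hρr)
  have hnhds : ball (0 : ℂ) r ∈ nhds (0 : ℂ) := isOpen_ball.mem_nhds h0
  set a := φ 0
  set b := deriv φ 0
  have hinner (w : Y) : DifferentiableOn ℂ (fun t => inner ℂ w (φ t)) (ball 0 r) :=
    (innerSL ℂ w).differentiable.comp_differentiableOn hφ
  have hb : deriv (fun t => inner ℂ b (φ t)) 0 = inner ℂ b b :=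
    ((innerSL ℂ b).hasFDerivAt.comp_hasDerivAt (0 : ℂ)
      (hφ.differentiableAt hnhds).hasDerivAt).deriv
  let G : ℂ → ℂ := fun t => inner ℂ a (φ t) + (ρ : ℂ) ^ 2 * dslope (fun t => inner ℂ b (φ t)) 0 t
  have hG : DifferentiableOn ℂ G (ball 0 r) :=
    (hinner a).add (((Complex.differentiableOn_dslope hnhds).2 (hinner b)).const_mul _)
  have hG0 : (G 0).re = ‖a‖ ^ 2 + ρ ^ 2 * ‖b‖ ^ 2 := by
    simp only [G, dslope_same, hb]
    rw [inner_self_eq_norm_sq_to_K, inner_self_eq_norm_sq_to_K]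
    simp [← Complex.ofReal_pow]
  have key := re_center_le_of_re_le_on_sphere hρ hρr hG
    (C := (M ^ 2 + ‖a‖ ^ 2 + ρ ^ 2 * ‖b‖ ^ 2) / 2) (fun t ht => by
      have htn : ‖t‖ = ρ := by simpa using ht
      have ht0 : t ≠ 0 := norm_pos_iff.1 (htn ▸ hρ)
      have hconj : (ρ : ℂ) ^ 2 = t * (starRingEnd ℂ) t := by
        rw [Complex.mul_conj, Complex.normSq_eq_norm_sq, htn]; push_cast; rfl
      have hGt : G t = inner ℂ (a + t • b) (φ t) - inner ℂ (t • b) a := by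
        simp only [G, dslope_of_ne _ ht0, slope_def_field, hconj, inner_add_left, inner_smul_left]
        field_simp
        ring
      have h1 := norm_sub_sq (𝕜 := ℂ) (a + t • b) (φ t)
      have h2 := norm_add_sq (𝕜 := ℂ) a (t • b)
      have h3 : (inner ℂ (t • b) a).re = (inner ℂ a (t • b)).re := inner_re_symm (𝕜 := ℂ) _ _
      have h4 : ‖φ t‖ ^ 2 ≤ M ^ 2 :=
        pow_le_pow_left₀ (norm_nonneg _) (hM t (by simpa [htn] using hρr)) 2
      rw [norm_smul, htn, mul_pow] at h2
      simp only [RCLike.re_to_complex] at h1 h2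
      rw [hGt, Complex.sub_re, h3]
      nlinarith [sq_nonneg ‖a + t • b - φ t‖])
  rw [hG0] at key
  linarith

/-- A preconnected set meeting both `D` and its complement meets the frontier of `D`. -/
theorem IsPreconnected.inter_frontier_nonempty {α : Type*} [TopologicalSpace α] {s D : Set α}
    (hs : IsPreconnected s) (h₁ : (s ∩ D).Nonempty) (h₂ : (s ∩ Dᶜ).Nonempty) :
    (s ∩ frontier D).Nonempty := by
  by_contra h
  have hcl : ∀ y ∈ s, y ∈ closure D → y ∈ interior D := fun y hy hyc => by
    by_contra hyi
    exact h ⟨y, hy, hyc, hyi⟩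
  obtain ⟨x, hxs, hxD⟩ := h₁
  obtain ⟨y, hys, hyD⟩ := h₂
  obtain ⟨z, -, hzi, hzc⟩ := hs (interior D) (closure D)ᶜ isOpen_interior
    isClosed_closure.isOpen_compl (fun z hz => (em (z ∈ closure D)).imp (hcl z hz) id)
    ⟨x, hxs, hcl x hxs (subset_closure hxD)⟩
    ⟨y, hys, fun hyc => hyD (interior_subset (hcl y hys hyc))⟩
  exact hzc (subset_closure (interior_subset hzi))

/-- A ball around a point of `D` that stays away from the frontier of `D` lies in `D`. -/
theorem ball_subset_of_le_infDist_frontier {X : Type*} [NormedAddCommGroup X] [NormedSpace ℝ X]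
    {D : Set X} {x : X} (hx : x ∈ D) {r : ℝ} (hrd : r ≤ Metric.infDist x (frontier D)) :
    Metric.ball x r ⊆ D := by
  intro y hy
  have hr : 0 < r := dist_nonneg.trans_lt hy
  by_contra hyD
  obtain ⟨z, hz, hzD⟩ := IsPreconnected.inter_frontier_nonempty
    (convex_ball x r).isPreconnected
    ⟨x, Metric.mem_ball_self hr, hx⟩ ⟨y, hy, hyD⟩
  have h := Metric.infDist_le_dist_of_mem (x := x) hzD
  rw [Metric.mem_ball'] at hz
  linarith

open Metric in
/-- Schwarz–Pick type estimate on a ball. -/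
theorem norm_fderiv_le_sqrt {X Y : Type*} [NormedAddCommGroup X] [NormedSpace ℂ X]
    [NormedAddCommGroup Y] [InnerProductSpace ℂ Y] {f : X → Y} {df : X → X →L[ℂ] Y}
    {x : X} {r M : ℝ} (hr : 0 < r) (hf : ∀ z ∈ ball x r, HasFDerivAt f (df z) z)
    (hM : ∀ z ∈ ball x r, ‖f z‖ ≤ M) :
    ‖df x‖ ≤ (1 / r) * Real.sqrt (M ^ 2 - ‖f x‖ ^ 2) := by
  refine ContinuousLinearMap.opNorm_le_of_unit_norm (𝕜 := ℂ) (by positivity) fun u hu => ?_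
  have hmem : ∀ t ∈ ball (0 : ℂ) r, x + t • u ∈ ball x r := fun t ht => by
    simpa [norm_smul, hu] using ht
  have hline (t : ℂ) : HasDerivAt (fun t : ℂ => x + t • u) u t := by
    simpa using ((hasDerivAt_id t).smul_const u).const_add x
  have hder : ∀ t ∈ ball (0 : ℂ) r,
      HasDerivAt (fun t : ℂ => f (x + t • u)) (df (x + t • u) u) t := fun t ht =>
    (hf _ (hmem t ht)).comp_hasDerivAt t (hline t)
  have h0 : deriv (fun t : ℂ => f (x + t • u)) 0 = df x u := by
    simpa using (hder 0 (mem_ball_self hr)).deriv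
  have hlt : ∀ ρ ∈ Set.Ioo 0 r, ρ * ‖df x u‖ ≤ Real.sqrt (M ^ 2 - ‖f x‖ ^ 2) := fun ρ hρ => by
    have h := sq_norm_add_sq_norm_deriv_le hρ.1 hρ.2
      (fun t ht => (hder t ht).differentiableAt.differentiableWithinAt) fun t ht => hM _ (hmem t ht)
    rw [h0] at h
    simp only [zero_smul, add_zero] at h
    apply Real.le_sqrt_of_sq_le
    rw [mul_pow]
    linarith
  have hle : r * ‖df x u‖ ≤ Real.sqrt (M ^ 2 - ‖f x‖ ^ 2) := by
    refine ContinuousWithinAt.closure_le (s := Set.Ioo 0 r) (f := fun ρ => ρ * ‖df x u‖) ?_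
      (by fun_prop) continuousWithinAt_const hlt
    rw [closure_Ioo hr.ne]
    exact Set.right_mem_Icc.2 hr.le
  rw [one_div, ← div_eq_inv_mul, le_div_iff₀ hr]
  linarith


/-- A bounded analytic mapping from a domain with nonempty boundary in a complex normed
space into a complex inner product space satisfies, for `0 < r < dist(x, ∂D)` and
`M = sup_{y ∈ B(x,r)} ‖f(y)‖`, the Schwarz–Pick type estimate
`‖df(x)‖ ≤ (1/r)·√(M² - ‖f(x)‖²)`, and consequently is `2`-regular with constant `K = 1`. -/
theorem stmt13 {X Y : Type*} [NormedAddCommGroup X] [NormedSpace ℂ X]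
    [NormedAddCommGroup Y] [InnerProductSpace ℂ Y]
    (D : Set X) (hD : IsOpen D) (hDconn : IsConnected D)
    (hfr : (frontier D).Nonempty)
    (f : X → Y) (df : X → X →L[ℂ] Y)
    (hf : ∀ z ∈ D, HasFDerivAt f (df z) z)
    (B : ℝ) (hB : ∀ z ∈ D, ‖f z‖ ≤ B)
    (x : X) (hx : x ∈ D) (r : ℝ) (hr : 0 < r)
    (hrd : r < Metric.infDist x (frontier D)) :
    ‖df x‖ ≤ (1 / r) *
        Real.sqrt ((sSup ((fun y => ‖f y‖) '' Metric.ball x r)) ^ 2 - ‖f x‖ ^ 2) ∧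
    ‖df x‖ ≤ (1 / r) *
        sSup ((fun y => |‖f y‖ ^ 2 - ‖f x‖ ^ 2| ^ ((1 : ℝ) / 2)) '' Metric.ball x r) := by
  have hsub : Metric.ball x r ⊆ D := ball_subset_of_le_infDist_frontier hx hrd.le
  have hbdd : BddAbove ((fun y => ‖f y‖) '' Metric.ball x r) := by
    refine ⟨B, ?_⟩
    rintro _ ⟨y, hy, rfl⟩
    exact hB y (hsub hy)
  have hbdd' : BddAbove
      ((fun y => |‖f y‖ ^ 2 - ‖f x‖ ^ 2| ^ ((1 : ℝ) / 2)) '' Metric.ball x r) := by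
    refine ⟨(B ^ 2) ^ ((1 : ℝ) / 2), ?_⟩
    rintro _ ⟨y, hy, rfl⟩
    have h1 : ‖f y‖ ^ 2 ≤ B ^ 2 := pow_le_pow_left₀ (norm_nonneg _) (hB y (hsub hy)) 2
    have h2 : ‖f x‖ ^ 2 ≤ B ^ 2 := pow_le_pow_left₀ (norm_nonneg _) (hB x hx) 2
    refine Real.rpow_le_rpow (abs_nonneg _) (abs_le.2 ⟨?_, ?_⟩) (by norm_num) <;>
      nlinarith [sq_nonneg ‖f x‖, sq_nonneg ‖f y‖]
  have main := norm_fderiv_le_sqrt hr (fun z hz => hf z (hsub hz))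
    fun z hz => le_csSup hbdd (Set.mem_image_of_mem _ hz)
  refine ⟨main, main.trans (mul_le_mul_of_nonneg_left ?_ (by positivity))⟩
  set s := sSup ((fun y => |‖f y‖ ^ 2 - ‖f x‖ ^ 2| ^ ((1 : ℝ) / 2)) '' Metric.ball x r)
  have hs : ∀ y ∈ Metric.ball x r, Real.sqrt |‖f y‖ ^ 2 - ‖f x‖ ^ 2| ≤ s := fun y hy => by
    rw [Real.sqrt_eq_rpow]
    exact le_csSup hbdd' ⟨y, hy, rfl⟩
  have hs0 : 0 ≤ s := (Real.sqrt_nonneg _).trans (hs x (Metric.mem_ball_self hr))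
  have hM0 : 0 ≤ sSup ((fun y => ‖f y‖) '' Metric.ball x r) :=
    (norm_nonneg (f x)).trans (le_csSup hbdd ⟨x, Metric.mem_ball_self hr, rfl⟩)
  have hM : sSup ((fun y => ‖f y‖) '' Metric.ball x r) ≤ Real.sqrt (s ^ 2 + ‖f x‖ ^ 2) := by
    refine csSup_le ((Metric.nonempty_ball.2 hr).image _) ?_
    rintro _ ⟨y, hy, rfl⟩
    have h := (Real.sqrt_le_left hs0).1 (hs y hy)
    exact Real.le_sqrt_of_sq_le (by linarith [le_abs_self (‖f y‖ ^ 2 - ‖f x‖ ^ 2)])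
  rw [Real.le_sqrt hM0 (by positivity)] at hM
  rw [Real.sqrt_le_left hs0]
  linarith
end

section
/- Let α ∈ (0, 1), let D be a c-uniform domain in a complex normed space X, and let f : D → ℂ be a bounded analytic function. Suppose there is C ≥ 0 such that ||f(y)| − |f(x)|| ≤ C·‖x − y‖^α whenever x ∈ D and ‖y − x‖ < dist(x, ∂D)/2. Then |f(z) − f(w)| ≤ (8c/α)·C·‖z − w‖^α for all z, w ∈ D. -/
open Set Metric Filter Topology

/-- The open ball around a point of an open set whose radius is the distance to the frontier lies
in the set. -/
theorem ball_infDist_frontier_subset {X : Type*} [NormedAddCommGroup X] [NormedSpace ℝ X]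
    {D : Set X} (hD : IsOpen D) {x : X} (hx : x ∈ D) :
    ball x (infDist x (frontier D)) ⊆ D := by
  rcases le_or_gt (infDist x (frontier D)) 0 with h | h
  · simp [ball_eq_empty.2 h]
  refine (convex_ball x _).isPreconnected.subset_left_of_subset_union hD
    isClosed_closure.isOpen_compl
    (disjoint_compl_right_iff_subset.2 subset_closure) (fun y hy => ?_) ⟨x, mem_ball_self h, hx⟩
  by_contra hy'
  simp only [mem_union, mem_compl_iff, not_or, not_not] at hy'
  have hyf : y ∈ frontier D := by
    rw [hD.frontier_eq]
    exact ⟨hy'.2, hy'.1⟩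
  have := infDist_le_dist_of_mem hyf (x := x)
  rw [mem_ball, dist_comm] at hy
  linarith

/-- If `‖f‖` exceeds `‖f x‖` by at most `A` on the ball `B(x, r)`, then `f` satisfies a
Borel–Carathéodory type estimate there. -/
theorem norm_sub_mul_le_of_norm_le_add {X : Type*} [NormedAddCommGroup X] [NormedSpace ℂ X]
    {f : X → ℂ} {x : X} {r A : ℝ} (hf : DifferentiableOn ℂ f (ball x r)) (hA : 0 ≤ A)
    (hbd : ∀ y ∈ ball x r, ‖f y‖ ≤ ‖f x‖ + A) {y : X} (hy : y ∈ ball x r) :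
    ‖f y - f x‖ * (r - ‖y - x‖) ≤ 2 * A * ‖y - x‖ := by
  have hr : 0 < r := nonempty_ball.1 ⟨y, hy⟩
  wlog hA' : 0 < A generalizing A
  · have hcont : Continuous fun B : ℝ => 2 * B * ‖y - x‖ := by fun_prop
    refine ge_of_tendsto (hcont.continuousWithinAt (s := Ioi A) (x := A)).tendsto ?_
    filter_upwards [self_mem_nhdsWithin] with B (hB : A < B)
    exact this (hA.trans hB.le) (fun z hz => (hbd z hz).trans (by linarith)) (hA.trans_lt hB)
  obtain ⟨θ, hθ, hθx⟩ : ∃ θ : ℂ, ‖θ‖ = 1 ∧ θ * f x = ‖f x‖ := by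
    rcases eq_or_ne (f x) 0 with h | h
    · exact ⟨1, by simp, by simp [h]⟩
    · have h' : (‖f x‖ : ℂ) ≠ 0 := by simpa using h
      refine ⟨‖f x‖ / f x, by simp [h], by field_simp⟩
  set u : X → ℂ := fun z => θ * (f z - f x) with hu
  have hnu : ∀ z, ‖u z‖ = ‖f z - f x‖ := fun z => by simp [hu, hθ]
  have hre : ∀ z ∈ ball x r, (u z).re ≤ A := by
    intro z hz
    have h1 : u z = θ * f z - ‖f x‖ := by simp only [hu, mul_sub, hθx]
    have h2 : (θ * f z).re ≤ ‖f z‖ := (Complex.re_le_norm _).trans (by simp [hθ])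
    have h3 := hbd z hz
    rw [h1, Complex.sub_re, Complex.ofReal_re]
    linarith
  have hne : ∀ z ∈ ball x r, 2 * (A : ℂ) - u z ≠ 0 := by
    intro z hz h
    have h1 := hre z hz
    have h2 := congrArg Complex.re h
    simp at h2
    linarith
  have hle : ∀ z ∈ ball x r, ‖u z‖ ≤ ‖2 * (A : ℂ) - u z‖ := by
    intro z hz
    rw [← sq_le_sq₀ (by positivity) (by positivity)]
    suffices (u z).re * (u z).re ≤ (2 * A - (u z).re) * (2 * A - (u z).re) by
      simpa [Complex.sq_norm, Complex.normSq_apply]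
    nlinarith [hre z hz]
  have hud : DifferentiableOn ℂ u (ball x r) := (hf.sub_const _).const_mul _
  have hux : u x = 0 := by simp [hu]
  have hdiv : DifferentiableOn ℂ (fun z => u z / (2 * A - u z)) (ball x r) := by
    simp only [div_eq_mul_inv]
    exact hud.mul ((hud.const_sub _).fun_inv hne)
  have key := Complex.dist_le_div_mul_dist_of_mapsTo_ball (R₂ := 1)
    (f := fun z => u z / (2 * A - u z)) hdiv (fun z hz => by
      simpa [hux] using div_le_one_of_le₀ (hle z hz) (norm_nonneg _)) hy
  simp only [hux, zero_div, dist_zero_right, norm_div] at key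
  rw [div_le_iff₀ (norm_pos_iff.2 (hne y hy)), dist_eq_norm, hnu] at key
  have h4 : ‖2 * (A : ℂ) - u y‖ ≤ 2 * A + ‖f y - f x‖ := by
    refine (norm_sub_le _ _).trans ?_
    rw [hnu]
    simp [abs_of_pos hA']
  have h5 := key.trans (mul_le_mul_of_nonneg_left h4 (by positivity))
  have h6 : 1 / r * ‖y - x‖ * (2 * A + ‖f y - f x‖)
      = (‖y - x‖ * (2 * A + ‖f y - f x‖)) / r := by ring
  rw [h6, le_div_iff₀ hr] at h5
  linarith

/-- Growth estimate along a `1`-Lipschitz curve whose distance to the frontier grows at least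
linearly. -/
theorem norm_sub_le_rpow_of_curve {X : Type*} [NormedAddCommGroup X] [NormedSpace ℂ X]
    {α c C T : ℝ} (hα : 0 < α) (hα1 : α < 1) (hc : 0 < c) (hC : 0 ≤ C) (hT : 0 ≤ T)
    {D : Set X} (hD : IsOpen D) {f : X → ℂ} (hf : DifferentiableOn ℂ f D)
    (hloc : ∀ x ∈ D, ∀ y : X, ‖y - x‖ < infDist x (frontier D) / 2 →
      |‖f y‖ - ‖f x‖| ≤ C * ‖x - y‖ ^ α)
    {G : ℝ → X} (hGD : ∀ s ∈ Icc 0 T, G s ∈ D)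
    (hGlip : ∀ s ∈ Icc 0 T, ∀ t ∈ Icc 0 T, ‖G s - G t‖ ≤ |s - t|)
    (hGdist : ∀ s ∈ Icc 0 T, s ≤ c * infDist (G s) (frontier D)) :
    ‖f (G T) - f (G 0)‖ ≤ 2 * C * (2 * c) ^ (1 - α) / α * T ^ α := by
  set K : ℝ := 2 * C * (2 * c) ^ (1 - α) with hK
  have hGc : ContinuousOn G (Icc 0 T) := by
    refine (LipschitzOnWith.of_dist_le_mul (K := 1) fun s hs t ht => ?_).continuousOn
    simpa [dist_eq_norm] using hGlip s hs t ht
  have hFc : ContinuousOn (fun s => f (G s)) (Icc 0 T) := hf.continuousOn.comp hGc hGD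
  rcases hT.eq_or_lt with rfl | hT
  · simp [Real.zero_rpow hα.ne']
  have main : ∀ a ∈ Ioo 0 T, ‖f (G T) - f (G a)‖ ≤ K / α * T ^ α := by
    intro a ha
    have hsub : Icc a T ⊆ Icc 0 T := Icc_subset_Icc_left ha.1.le
    refine image_le_of_liminf_slope_right_le_deriv_boundary
      (f := fun s => ‖f (G s) - f (G a)‖) (a := a) (b := T)
      (B := fun s => K / α * s ^ α) (B' := fun s => K * s ^ (α - 1))
      ((hFc.mono hsub).sub continuousOn_const).norm ?_ ?_ ?_ ?_ ⟨ha.2.le, le_rfl⟩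
    · have := ha.1
      simp only [sub_self, norm_zero]
      positivity
    · exact (continuous_const.mul (Real.continuous_rpow_const hα.le)).continuousOn
    · intro s hs
      have hs0 : 0 < s := ha.1.trans_le hs.1
      have h := ((Real.hasDerivAt_rpow_const (p := α) (Or.inl hs0.ne')).const_mul (K / α))
      refine (h.congr_deriv ?_).hasDerivWithinAt
      field_simp
    · intro s hs r hr
      have hs0 : 0 < s := ha.1.trans_le hs.1
      have hsI : s ∈ Icc 0 T := ⟨hs0.le, hs.2.le⟩
      have hxD := hGD s hsI
      set ρ : ℝ := infDist (G s) (frontier D) / 2 with hρ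
      have hsρ : s / (2 * c) ≤ ρ := by
        rw [div_le_iff₀ (by positivity)]
        exact (hGdist s hsI).trans_eq (by rw [hρ]; ring)
      have hρ0 : 0 < ρ := lt_of_lt_of_le (by positivity) hsρ
      have hball : ball (G s) ρ ⊆ D :=
        (ball_subset_ball (by linarith)).trans (ball_infDist_frontier_subset hD hxD)
      have hest : ∀ y ∈ ball (G s) ρ,
          ‖f y - f (G s)‖ * (ρ - ‖y - G s‖) ≤ 2 * (C * ρ ^ α) * ‖y - G s‖ := by
        intro y hy
        refine norm_sub_mul_le_of_norm_le_add (hf.mono hball) (by positivity) (fun z hz => ?_) hy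
        rw [mem_ball, dist_eq_norm] at hz
        have h1 := (le_abs_self _).trans (hloc _ hxD z hz)
        have h2 : C * ‖G s - z‖ ^ α ≤ C * ρ ^ α := by
          rw [norm_sub_rev]
          gcongr
        linarith
      have hlim : 2 * (C * ρ ^ α) / (ρ - 0) < r := by
        refine lt_of_le_of_lt ?_ hr
        have h1 : ρ ^ (α - 1) ≤ (s / (2 * c)) ^ (α - 1) :=
          Real.rpow_le_rpow_of_nonpos (by positivity) hsρ (by linarith)
        have h2 : (s / (2 * c)) ^ (α - 1) = s ^ (α - 1) * (2 * c) ^ (1 - α) := by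
          rw [Real.div_rpow hs0.le (by positivity), ← neg_sub 1 α, Real.rpow_neg (x := 2 * c)
            (by positivity), div_inv_eq_mul]
        calc 2 * (C * ρ ^ α) / (ρ - 0) = 2 * C * ρ ^ (α - 1) := by
              rw [Real.rpow_sub_one hρ0.ne', sub_zero]; ring
          _ ≤ 2 * C * (s ^ (α - 1) * (2 * c) ^ (1 - α)) := by
              rw [← h2]; gcongr
          _ = K * s ^ (α - 1) := by rw [hK]; ring
      have htend : Tendsto (fun z => 2 * (C * ρ ^ α) / (ρ - (z - s))) (𝓝[>] s)
          (𝓝 (2 * (C * ρ ^ α) / (ρ - 0))) := by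
        have hz : Tendsto (fun z : ℝ => z - s) (𝓝 s) (𝓝 0) := by
          simpa using (tendsto_id (α := ℝ) (x := 𝓝 s)).sub_const s
        exact (tendsto_const_nhds.div (tendsto_const_nhds.sub hz)
          (by simpa using hρ0.ne')).mono_left nhdsWithin_le_nhds
      refine Eventually.frequently ?_
      filter_upwards [htend.eventually_lt_const hlim, self_mem_nhdsWithin,
        Ioo_mem_nhdsGT (show s < min T (s + ρ) from lt_min hs.2 (by linarith))]
        with z hz (hsz : s < z) hzT
      have hzI : z ∈ Icc 0 T := ⟨by linarith, (hzT.2.trans_le (min_le_left _ _)).le⟩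
      have hzρ : 0 < ρ - (z - s) := by linarith [hzT.2.trans_le (min_le_right T (s + ρ))]
      have hnorm : ‖G z - G s‖ ≤ z - s := by
        simpa [abs_of_pos (sub_pos.2 hsz)] using hGlip z hzI s hsI
      have h1 := hest (G z) (by rw [mem_ball, dist_eq_norm]; linarith)
      have h2 : ‖f (G z) - f (G s)‖ * (ρ - (z - s)) ≤ 2 * (C * ρ ^ α) * (z - s) := by
        calc _ ≤ ‖f (G z) - f (G s)‖ * (ρ - ‖G z - G s‖) := by gcongr
          _ ≤ _ := h1
          _ ≤ _ := by gcongr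
      refine lt_of_le_of_lt ?_ hz
      rw [slope_def_field, div_le_div_iff₀ (sub_pos.2 hsz) hzρ]
      refine le_trans ?_ h2
      gcongr
      have := norm_sub_norm_le (f (G z) - f (G a)) (f (G s) - f (G a))
      simpa using this
  have h0 : Tendsto (fun a => ‖f (G T) - f (G a)‖) (𝓝[>] 0) (𝓝 ‖f (G T) - f (G 0)‖) := by
    have h := (hFc 0 ⟨le_rfl, hT.le⟩).tendsto.mono_left
      (nhdsWithin_mono _ (Ioc_subset_Icc_self : Ioc 0 T ⊆ Icc 0 T))
    rw [nhdsWithin_Ioc_eq_nhdsGT hT] at h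
    exact (tendsto_const_nhds.sub h).norm
  refine le_of_tendsto h0 ?_
  filter_upwards [Ioo_mem_nhdsGT hT] with a ha
  exact main a ha


/-- Dyakonov type theorem on uniform domains (one-dimensional range): if `f` is a bounded
analytic function on a `c`-uniform domain `D` in a complex normed space and `|f|` is locally
`α`-Hölder with constant `C` (on balls `B(x, dist(x,∂D)/2)`), then `f` is globally `α`-Hölder
on `D` with constant `(8c/α)·C`. -/
theorem stmt15 {X : Type*} [NormedAddCommGroup X] [NormedSpace ℂ X]
    (α : ℝ) (hα : α ∈ Set.Ioo (0 : ℝ) 1) (c : ℝ) (hc : 0 < c)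
    (D : Set X) (hD : IsOpen D) (hDconn : IsConnected D)
    (hfr : (frontier D).Nonempty)
    (huniform : ∀ x ∈ D, ∀ y ∈ D, ∃ L : ℝ, 0 ≤ L ∧ ∃ γ : ℝ → X,
      (∀ s ∈ Set.Icc (0 : ℝ) L, γ s ∈ D) ∧
      Set.InjOn γ (Set.Icc (0 : ℝ) L) ∧
      (∀ s t : ℝ, 0 ≤ s → s ≤ t → t ≤ L →
        eVariationOn γ (Set.Icc s t) = ENNReal.ofReal (t - s)) ∧
      γ 0 = x ∧ γ L = y ∧ L ≤ c * ‖x - y‖ ∧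
      ∀ s ∈ Set.Icc (0 : ℝ) L,
        min s (L - s) ≤ c * Metric.infDist (γ s) (frontier D))
    (f : X → ℂ) (hf : DifferentiableOn ℂ f D)
    (B : ℝ) (hB : ∀ z ∈ D, ‖f z‖ ≤ B)
    (C : ℝ) (hC : 0 ≤ C)
    (hloc : ∀ x ∈ D, ∀ y : X, ‖y - x‖ < Metric.infDist x (frontier D) / 2 →
      |‖f y‖ - ‖f x‖| ≤ C * ‖x - y‖ ^ α) :
    ∀ z ∈ D, ∀ w ∈ D, ‖f z - f w‖ ≤ (8 * c / α) * C * ‖z - w‖ ^ α := by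
  intro z hz w hw
  obtain ⟨hα0, hα1⟩ := hα
  obtain ⟨L, hL, γ, hγD, -, hγvar, hγ0, hγL, hLc, hγdist⟩ := huniform z hz w hw
  have hlip' : ∀ s t : ℝ, 0 ≤ s → s ≤ t → t ≤ L → ‖γ s - γ t‖ ≤ t - s := by
    intro s t h0 hst htL
    have h := eVariationOn.edist_le γ (s := Set.Icc s t) (x := s) (y := t)
      ⟨le_rfl, hst⟩ ⟨hst, le_rfl⟩
    rw [hγvar s t h0 hst htL, edist_dist,
      ENNReal.ofReal_le_ofReal_iff (sub_nonneg.2 hst), dist_eq_norm] at h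
    exact h
  have hlip : ∀ s ∈ Set.Icc 0 L, ∀ t ∈ Set.Icc 0 L, ‖γ s - γ t‖ ≤ |s - t| := by
    intro s hs t ht
    rcases le_total s t with h | h
    · rw [abs_sub_comm, abs_of_nonneg (sub_nonneg.2 h)]
      exact hlip' s t hs.1 h ht.2
    · rw [norm_sub_rev, abs_of_nonneg (sub_nonneg.2 h)]
      exact hlip' t s ht.1 h hs.2
  have hmem : ∀ s ∈ Set.Icc 0 (L / 2), s ∈ Set.Icc 0 L ∧ L - s ∈ Set.Icc 0 L := fun s hs =>
    ⟨⟨hs.1, by linarith [hs.2]⟩, by linarith [hs.2], by linarith [hs.1]⟩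
  have h1 := norm_sub_le_rpow_of_curve hα0 hα1 hc hC (T := L / 2) (by positivity) hD hf hloc
    (G := γ) (fun s hs => hγD s (hmem s hs).1)
    (fun s hs t ht => hlip s (hmem s hs).1 t (hmem t ht).1)
    (fun s hs => by
      have h := hγdist s (hmem s hs).1
      rwa [min_eq_left (by linarith [hs.2])] at h)
  have h2 := norm_sub_le_rpow_of_curve hα0 hα1 hc hC (T := L / 2) (by positivity) hD hf hloc
    (G := fun s => γ (L - s)) (fun s hs => hγD _ (hmem s hs).2)
    (fun s hs t ht => (hlip _ (hmem s hs).2 _ (hmem t ht).2).trans_eq (by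
      rw [sub_sub_sub_cancel_left, abs_sub_comm]))
    (fun s hs => by
      have h := hγdist _ (hmem s hs).2
      rwa [sub_sub_cancel, min_eq_right (by linarith [hs.2])] at h)
  simp only [sub_half, sub_zero, hγL, hγ0] at h1 h2
  have h3 : ‖f z - f w‖ ≤ 2 * (2 * C * (2 * c) ^ (1 - α) / α * (L / 2) ^ α) := by
    have h := norm_sub_le_norm_sub_add_norm_sub (f z) (f (γ (L / 2))) (f w)
    rw [norm_sub_rev (f z) (f (γ (L / 2)))] at h
    linarith
  have h4 : (L / 2) ^ α ≤ (2 * c) ^ α * ‖z - w‖ ^ α := by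
    rw [← Real.mul_rpow (by positivity) (norm_nonneg _)]
    refine Real.rpow_le_rpow (by positivity) ?_ hα0.le
    nlinarith [mul_nonneg hc.le (norm_nonneg (z - w))]
  have h5 : (2 * c) ^ (1 - α) * (2 * c) ^ α = 2 * c := by
    rw [← Real.rpow_add (by positivity), sub_add_cancel, Real.rpow_one]
  calc ‖f z - f w‖ ≤ 2 * (2 * C * (2 * c) ^ (1 - α) / α * (L / 2) ^ α) := h3
    _ ≤ 2 * (2 * C * (2 * c) ^ (1 - α) / α * ((2 * c) ^ α * ‖z - w‖ ^ α)) := by gcongr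
    _ = 4 * C / α * ((2 * c) ^ (1 - α) * (2 * c) ^ α) * ‖z - w‖ ^ α := by ring
    _ = (8 * c / α) * C * ‖z - w‖ ^ α := by rw [h5]; ring
end

section
/- (Dyakonov's theorem) Let α ∈ (0, 1) and let f be analytic on the open unit disk 𝔻 ⊆ ℂ. Then there exists a constant C ≥ 0 with |f(z) − f(w)| ≤ C·|z − w|^α for all z, w ∈ 𝔻 if and only if there exists a constant C' ≥ 0 with ||f(z)| − |f(w)|| ≤ C'·|z − w|^α for all z, w ∈ 𝔻. -/
open Metric Set

/-- A holomorphic function on a disc whose modulus exceeds its value at the center by at most `ε`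
has derivative at most `4 * ε / R` at the center. -/
theorem norm_deriv_le_of_norm_le_add {f : ℂ → ℂ} {c : ℂ} {R ε : ℝ} (hR : 0 < R) (hε : 0 < ε)
    (hf : DifferentiableOn ℂ f (ball c R)) (hle : ∀ z ∈ ball c R, ‖f z‖ ≤ ‖f c‖ + ε) :
    ‖deriv f c‖ ≤ 4 * ε / R := by
  obtain ⟨u, hu, huc⟩ := RCLike.exists_norm_eq_mul_self (f c)
  have hmaps : MapsTo (fun z => c + z) (ball 0 R) (ball c R) := fun z hz => by
    simpa using hz
  set g : ℂ → ℂ := fun z => u * (f (c + z) - f c) with hg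
  have hgd : DifferentiableOn ℂ g (ball 0 R) :=
    ((hf.comp (by fun_prop) hmaps).sub_const _).const_mul u
  have hre : MapsTo g (ball 0 R) {z | z.re ≤ ε} := fun z hz => by
    have h₁ : (u * f (c + z)).re ≤ ‖f (c + z)‖ := by
      simpa [hu] using Complex.re_le_norm (u * f (c + z))
    have h₂ : (u * f c).re = ‖f c‖ := by rw [← huc]; simp
    have h₃ := hle _ (hmaps hz)
    change (u * (f (c + z) - f c)).re ≤ ε
    rw [mul_sub, Complex.sub_re]
    linarith
  have hbound : ∀ z ∈ sphere (0 : ℂ) (R / 2), ‖g z‖ ≤ 2 * ε := fun z hz => by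
    have hz' : ‖z‖ = R / 2 := by simpa using hz
    have h := Complex.borelCaratheodory_zero hε hgd hre hR (z := z)
      (by simp [hz', hR]) (by simp [hg])
    rw [hz'] at h
    convert h using 1
    field_simp
    ring
  have hcl : DiffContOnCl ℂ g (ball 0 (R / 2)) :=
    (hgd.mono (closedBall_subset_ball (by linarith))).diffContOnCl_ball subset_rfl
  have h := Complex.norm_deriv_le_of_forall_mem_sphere_norm_le (half_pos hR) hcl hbound
  have hderiv : deriv g 0 = u * deriv f c := by
    have hfc : HasDerivAt f (deriv f c) (c + 0) := by
      simpa using (hf.differentiableAt (ball_mem_nhds c hR)).hasDerivAt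
    exact ((hfc.comp_const_add c 0).sub_const (f c)).const_mul u |>.deriv
  rw [hderiv, norm_mul, hu, one_mul] at h
  refine h.trans_eq ?_
  field_simp
  ring

/-- Radial estimate in the Hardy–Littlewood theorem: if `‖f' z‖ ≤ K * (1 - ‖z‖) ^ (α - 1)` on the
unit disc, then `f` moves by at most `K / α * t ^ α` when `z` is shrunk by the factor `1 - t`. -/
theorem norm_sub_radial_le {f : ℂ → ℂ} {K α t : ℝ} {z : ℂ} (hK : 0 ≤ K) (hα : 0 < α) (hα' : α ≤ 1)
    (hf : DifferentiableOn ℂ f (ball 0 1))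
    (hd : ∀ z ∈ ball (0 : ℂ) 1, ‖deriv f z‖ ≤ K * (1 - ‖z‖) ^ (α - 1))
    (hz : z ∈ ball (0 : ℂ) 1) (ht : t ∈ Icc (0 : ℝ) 1) :
    ‖f ((1 - t : ℝ) * z) - f z‖ ≤ K / α * t ^ α := by
  have hz1 : ‖z‖ < 1 := by simpa using hz
  have hnorm : ∀ s ∈ Icc (0 : ℝ) t, ‖((1 - s : ℝ) : ℂ) * z‖ = (1 - s) * ‖z‖ := fun s hs => by
    rw [norm_mul, Complex.norm_real, Real.norm_of_nonneg (by linarith [hs.2, ht.2])]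
  have hpos : ∀ s ∈ Icc (0 : ℝ) t, 0 < 1 - ‖z‖ + s * ‖z‖ := fun s hs => by
    have := mul_nonneg hs.1 (norm_nonneg z)
    linarith
  have hmem : ∀ s ∈ Icc (0 : ℝ) t, ((1 - s : ℝ) : ℂ) * z ∈ ball (0 : ℂ) 1 := fun s hs => by
    rw [mem_ball_zero_iff, hnorm s hs]
    linarith [hpos s hs]
  have hφ : ∀ s ∈ Icc (0 : ℝ) t, HasDerivAt (fun s : ℝ => f ((1 - s : ℝ) * z) - f z)
      (deriv f ((1 - s : ℝ) * z) * -z) s := fun s hs => by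
    have h₁ := (hf.differentiableAt (isOpen_ball.mem_nhds (hmem s hs))).hasDerivAt
    have h₂ : HasDerivAt (fun s : ℝ => ((1 - s : ℝ) : ℂ) * z) (-z) s := by
      simpa using (((hasDerivAt_id s).const_sub 1).ofReal_comp).mul_const z
    exact (h₁.comp s h₂).sub_const _
  have hB : ∀ s ∈ Icc (0 : ℝ) t,
      HasDerivAt (fun s : ℝ => K / α * ((1 - ‖z‖ + s * ‖z‖) ^ α - (1 - ‖z‖) ^ α))
        (K * (1 - ‖z‖ + s * ‖z‖) ^ (α - 1) * ‖z‖) s := fun s hs => by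
    have h₁ : HasDerivAt (fun s : ℝ => 1 - ‖z‖ + s * ‖z‖) ‖z‖ s := by
      simpa using ((hasDerivAt_id s).mul_const ‖z‖).const_add (1 - ‖z‖)
    refine (((h₁.rpow_const (p := α) (Or.inl (hpos s hs).ne')).sub_const
      ((1 - ‖z‖) ^ α)).const_mul (K / α)).congr_deriv ?_
    field_simp
  have key := image_norm_le_of_norm_deriv_right_le_deriv_boundary'
    (fun s hs => (hφ s hs).continuousAt.continuousWithinAt)
    (fun s hs => (hφ s (Ico_subset_Icc_self hs)).hasDerivWithinAt) (by simp)
    (fun s hs => (hB s hs).continuousAt.continuousWithinAt)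
    (fun s hs => (hB s (Ico_subset_Icc_self hs)).hasDerivWithinAt)
    (fun s hs => by
      have hs' := Ico_subset_Icc_self hs
      have h := hd _ (hmem s hs')
      rw [hnorm s hs'] at h
      rw [norm_mul, norm_neg]
      rw [show 1 - ‖z‖ + s * ‖z‖ = 1 - (1 - s) * ‖z‖ by ring]
      gcongr) (right_mem_Icc.2 ht.1)
  refine key.trans (mul_le_mul_of_nonneg_left ?_ (by positivity))
  have h₁ := Real.rpow_add_le_add_rpow (a := 1 - ‖z‖) (b := t * ‖z‖) (by linarith)
    (mul_nonneg ht.1 (norm_nonneg z)) hα.le hα'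
  have h₂ : (t * ‖z‖) ^ α ≤ t ^ α :=
    Real.rpow_le_rpow (mul_nonneg ht.1 (norm_nonneg z))
      (mul_le_of_le_one_right ht.1 hz1.le) hα.le
  linarith

/-- **Hardy–Littlewood**: if `‖f' z‖ ≤ K * (1 - ‖z‖) ^ (α - 1)` on the unit disc, then `f` is
`α`-Hölder continuous there. -/
theorem norm_sub_le_of_norm_deriv_le_rpow {f : ℂ → ℂ} {K α : ℝ} (hK : 0 ≤ K) (hα : 0 < α)
    (hα' : α ≤ 1) (hf : DifferentiableOn ℂ f (ball 0 1))
    (hd : ∀ z ∈ ball (0 : ℂ) 1, ‖deriv f z‖ ≤ K * (1 - ‖z‖) ^ (α - 1))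
    {z w : ℂ} (hz : z ∈ ball (0 : ℂ) 1) (hw : w ∈ ball (0 : ℂ) 1) :
    ‖f z - f w‖ ≤ (2 * (K / α) + 2 * K) * ‖z - w‖ ^ α := by
  rcases eq_or_ne z w with rfl | hne
  · simp [Real.zero_rpow hα.ne']
  have hz1 : ‖z‖ < 1 := by simpa using hz
  have hw1 : ‖w‖ < 1 := by simpa using hw
  have hδ : 0 < ‖z - w‖ := norm_pos_iff.2 (sub_ne_zero.2 hne)
  obtain ⟨t, ht⟩ : ∃ t, t = ‖z - w‖ / 2 := ⟨_, rfl⟩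
  have ht0 : 0 < t := by linarith
  have ht1 : t ≤ 1 := by linarith [norm_sub_le z w]
  have hshrink : ∀ x : ℂ, ‖x‖ < 1 → ((1 - t : ℝ) : ℂ) * x ∈ closedBall (0 : ℂ) (1 - t) :=
    fun x hx => by
      rw [mem_closedBall_zero_iff, norm_mul, Complex.norm_real,
        Real.norm_of_nonneg (by linarith)]
      exact mul_le_of_le_one_right (by linarith) hx.le
  have hsub : closedBall (0 : ℂ) (1 - t) ⊆ ball 0 1 := closedBall_subset_ball (by linarith)
  have hmid : ‖f ((1 - t : ℝ) * z) - f ((1 - t : ℝ) * w)‖ ≤ 2 * K * t ^ α := by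
    have h := (convex_closedBall (0 : ℂ) (1 - t)).norm_image_sub_le_of_norm_deriv_le
      (f := f) (C := K * t ^ (α - 1))
      (fun x hx => hf.differentiableAt (isOpen_ball.mem_nhds (hsub hx)))
      (fun x hx => (hd x (hsub hx)).trans <| mul_le_mul_of_nonneg_left
        (Real.rpow_le_rpow_of_nonpos ht0 (by linarith [mem_closedBall_zero_iff.1 hx])
          (by linarith)) hK)
      (hshrink w hw1) (hshrink z hz1)
    refine h.trans ?_
    have hle : ‖((1 - t : ℝ) : ℂ) * z - (1 - t : ℝ) * w‖ ≤ 2 * t := by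
      rw [← mul_sub, norm_mul, Complex.norm_real, Real.norm_of_nonneg (by linarith)]
      nlinarith
    calc K * t ^ (α - 1) * ‖((1 - t : ℝ) : ℂ) * z - (1 - t : ℝ) * w‖
        ≤ K * t ^ (α - 1) * (2 * t) := by gcongr
      _ = 2 * K * t ^ α := by
        rw [Real.rpow_sub_one ht0.ne']
        field_simp
  have hrz := norm_sub_radial_le hK hα hα' hf hd hz ⟨ht0.le, ht1⟩
  have hrw := norm_sub_radial_le hK hα hα' hf hd hw ⟨ht0.le, ht1⟩
  have htri : ‖f z - f w‖ ≤ ‖f ((1 - t : ℝ) * z) - f z‖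
      + ‖f ((1 - t : ℝ) * z) - f ((1 - t : ℝ) * w)‖ + ‖f ((1 - t : ℝ) * w) - f w‖ := by
    rw [← norm_sub_rev (f z)]
    refine le_trans (le_of_eq ?_) (norm_add₃_le)
    congr 1
    ring
  have htδ : t ^ α ≤ ‖z - w‖ ^ α := Real.rpow_le_rpow ht0.le (by linarith) hα.le
  calc ‖f z - f w‖ ≤ (2 * (K / α) + 2 * K) * t ^ α := by linarith
    _ ≤ (2 * (K / α) + 2 * K) * ‖z - w‖ ^ α := by gcongr

/-- Dyakonov's theorem: an analytic function on the unit disk is `α`-Hölder continuous if and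
only if its modulus is `α`-Hölder continuous. -/
theorem stmt17 (α : ℝ) (hα : α ∈ Set.Ioo (0 : ℝ) 1)
    (f : ℂ → ℂ) (hf : DifferentiableOn ℂ f (Metric.ball 0 1)) :
    (∃ C : ℝ, 0 ≤ C ∧ ∀ z ∈ Metric.ball (0 : ℂ) 1, ∀ w ∈ Metric.ball (0 : ℂ) 1,
        ‖f z - f w‖ ≤ C * ‖z - w‖ ^ α) ↔
    (∃ C' : ℝ, 0 ≤ C' ∧ ∀ z ∈ Metric.ball (0 : ℂ) 1, ∀ w ∈ Metric.ball (0 : ℂ) 1,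
        |‖f z‖ - ‖f w‖| ≤ C' * ‖z - w‖ ^ α) := by
  refine ⟨fun ⟨C, hC, h⟩ => ⟨C, hC, fun z hz w hw =>
    (abs_norm_sub_norm_le _ _).trans (h z hz w hw)⟩, fun ⟨C, hC, h⟩ => ?_⟩
  have hd : ∀ z ∈ ball (0 : ℂ) 1, ‖deriv f z‖ ≤ 4 * (C + 1) * (1 - ‖z‖) ^ (α - 1) := by
    intro z hz
    have hR : 0 < 1 - ‖z‖ := by simpa using hz
    have hsub : ball z (1 - ‖z‖) ⊆ ball 0 1 := ball_subset_ball' (by simp)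
    have h' := norm_deriv_le_of_norm_le_add (ε := (C + 1) * (1 - ‖z‖) ^ α) hR (by positivity)
      (hf.mono hsub) fun w hw => by
        have h₁ := (le_abs_self _).trans (h w (hsub hw) z hz)
        have h₂ : ‖w - z‖ ^ α ≤ (1 - ‖z‖) ^ α :=
          Real.rpow_le_rpow (norm_nonneg _) (mem_ball_iff_norm.1 hw).le hα.1.le
        have h₃ : C * ‖w - z‖ ^ α ≤ C * (1 - ‖z‖) ^ α := by gcongr
        have h₄ : 0 < (1 - ‖z‖) ^ α := by positivity
        linarith
    refine h'.trans_eq ?_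
    rw [Real.rpow_sub_one hR.ne']
    ring
  have hα₀ := hα.1
  exact ⟨2 * (4 * (C + 1) / α) + 2 * (4 * (C + 1)), by positivity, fun z hz w hw =>
    norm_sub_le_of_norm_deriv_le_rpow (by positivity) hα.1 hα.2.le hf hd hz hw⟩
end

section
/- (Hardy–Littlewood theorem on the unit disk, with explicit constants) Let α ∈ (0, 1), C ≥ 0, and let f be analytic on the open unit disk 𝔻 ⊆ ℂ. (i) If |f'(z)| ≤ C·(1 − |z|)^{α−1} for all z ∈ 𝔻, then |f(z) − f(w)| ≤ (4/α)·C·|z − w|^α for all z, w ∈ 𝔻. (ii) Conversely, if |f(z) − f(w)| ≤ C·|z − w|^α for all z, w ∈ 𝔻, then |f'(z)| ≤ C·(1 − |z|)^{α−1} for all z ∈ 𝔻. -/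
/-- If `‖f'‖ ≤ C (1 - ‖·‖) ^ (α - 1)` on the unit disk, then integrating along the segment from
`p` to `z` bounds `‖f z - f p‖` in terms of the distance from `p` to the boundary. -/
theorem norm_sub_le_of_norm_deriv_le_rpow_s18 {α : ℝ} (hα : α ∈ Set.Ioo (0 : ℝ) 1) {C : ℝ}
    (hC : 0 ≤ C) {f : ℂ → ℂ} (hf : DifferentiableOn ℂ f (Metric.ball 0 1))
    (h : ∀ z ∈ Metric.ball (0 : ℂ) 1, ‖deriv f z‖ ≤ C * (1 - ‖z‖) ^ (α - 1))
    {z p : ℂ} (hz : ‖z‖ < 1) (hp : ‖p‖ < 1) :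
    ‖f z - f p‖ ≤ C / α * (1 - ‖p‖) ^ (α - 1) * ‖z - p‖ := by
  obtain ⟨hα0, hα1⟩ := hα
  have hnorm : ∀ t ∈ Set.Icc (0 : ℝ) 1,
      (1 - t) * (1 - ‖p‖) + t * (1 - ‖z‖) ≤ 1 - ‖p + t * (z - p)‖ := by
    intro t ht
    have h1 : p + t * (z - p) = ((1 - t : ℝ) : ℂ) * p + (t : ℂ) * z := by
      push_cast; ring
    have h2 := norm_add_le (((1 - t : ℝ) : ℂ) * p) ((t : ℂ) * z)
    rw [← h1, norm_mul, norm_mul, Complex.norm_of_nonneg (by linarith [ht.2]),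
      Complex.norm_of_nonneg ht.1] at h2
    linarith
  have hmem : ∀ t ∈ Set.Icc (0 : ℝ) 1, p + t * (z - p) ∈ Metric.ball (0 : ℂ) 1 := by
    intro t ht
    rw [mem_ball_zero_iff]
    have := hnorm t ht
    rcases ht.1.eq_or_lt with rfl | h0
    · simpa using hp
    · nlinarith [mul_pos h0 (sub_pos.2 hz),
        mul_nonneg (sub_nonneg.2 ht.2) (sub_pos.2 hp).le]
  have hderiv : ∀ t ∈ Set.Icc (0 : ℝ) 1,
      HasDerivAt (fun t : ℝ => f (p + t * (z - p)) - f p)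
        (deriv f (p + t * (z - p)) * (z - p)) t := by
    intro t ht
    have h1 : HasDerivAt f (deriv f (p + t * (z - p))) (p + t * (z - p)) :=
      (hf.differentiableAt (Metric.isOpen_ball.mem_nhds (hmem t ht))).hasDerivAt
    have h2 : HasDerivAt (fun t : ℝ => p + t * (z - p)) (z - p) t := by
      simpa using ((Complex.ofRealCLM.hasDerivAt (x := t)).mul_const (z - p)).const_add p
    exact (h1.comp t h2).sub_const _
  set K := C * (1 - ‖p‖) ^ (α - 1) * ‖z - p‖ with hK
  have key := image_norm_le_of_norm_deriv_right_le_deriv_boundary'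
    (f := fun t : ℝ => f (p + t * (z - p)) - f p)
    (f' := fun t : ℝ => deriv f (p + t * (z - p)) * (z - p))
    (a := 0) (b := 1) (B := fun t => K / α * (1 - (1 - t) ^ α))
    (B' := fun t => K * (1 - t) ^ (α - 1))
    (fun t ht => (hderiv t ht).continuousAt.continuousWithinAt)
    (fun t ht => (hderiv t ⟨ht.1, ht.2.le⟩).hasDerivWithinAt)
    (by simp)
    (by
      refine Continuous.continuousOn (continuous_const.mul (continuous_const.sub ?_))
      exact (continuous_const.sub continuous_id).rpow_const fun _ => Or.inr hα0.le)
    (by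
      intro t ht
      have h1 : HasDerivAt (fun t : ℝ => 1 - t) (-1) t := by
        simpa using (hasDerivAt_id t).const_sub 1
      have h2 := ((h1.rpow_const (p := α) (Or.inl (sub_pos.2 ht.2).ne')).const_sub 1).const_mul
        (K / α)
      refine (h2.congr_deriv ?_).hasDerivWithinAt
      field_simp)
    (by
      intro t ht
      have ht' : t ∈ Set.Icc (0 : ℝ) 1 := ⟨ht.1, ht.2.le⟩
      have h1t : 0 < 1 - t := sub_pos.2 ht.2
      have hp' : 0 < 1 - ‖p‖ := sub_pos.2 hp
      have h1 : (1 - ‖p + t * (z - p)‖) ^ (α - 1) ≤ ((1 - t) * (1 - ‖p‖)) ^ (α - 1) :=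
        Real.rpow_le_rpow_of_nonpos (mul_pos h1t hp')
          (by nlinarith [hnorm t ht', mul_nonneg ht.1 (sub_pos.2 hz).le]) (by linarith)
      rw [Real.mul_rpow h1t.le hp'.le] at h1
      rw [norm_mul]
      calc _ ≤ C * ((1 - t) ^ (α - 1) * (1 - ‖p‖) ^ (α - 1)) * ‖z - p‖ := by
            gcongr
            exact (h _ (hmem t ht')).trans (by gcongr)
        _ = _ := by rw [hK]; ring)
    (Set.right_mem_Icc.2 zero_le_one)
  simp only [Complex.ofReal_one, one_mul, add_sub_cancel, sub_self,
    Real.zero_rpow hα0.ne', sub_zero, mul_one] at key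
  exact key.trans_eq (by rw [hK]; ring)

/-- Cauchy's estimate for the derivative of a Hölder function on the unit disk. -/
theorem norm_deriv_le_rpow_of_holder {α C : ℝ} {f : ℂ → ℂ}
    (hf : DifferentiableOn ℂ f (Metric.ball 0 1))
    (h : ∀ z ∈ Metric.ball (0 : ℂ) 1, ∀ w ∈ Metric.ball (0 : ℂ) 1,
      ‖f z - f w‖ ≤ C * ‖z - w‖ ^ α)
    {z : ℂ} (hz : ‖z‖ < 1) : ‖deriv f z‖ ≤ C * (1 - ‖z‖) ^ (α - 1) := by
  have hd : 0 < 1 - ‖z‖ := sub_pos.2 hz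
  have hr : ∀ r ∈ Set.Ioo 0 (1 - ‖z‖), ‖deriv f z‖ ≤ C * r ^ (α - 1) := by
    intro r hr
    have hsub : Metric.closedBall z r ⊆ Metric.ball 0 1 := by
      intro w hw
      rw [mem_closedBall_iff_norm] at hw
      rw [mem_ball_zero_iff]
      linarith [norm_le_norm_add_norm_sub' w z, hr.2]
    have hdiff : DiffContOnCl ℂ (fun w => f w - f z) (Metric.ball z r) := by
      refine DifferentiableOn.diffContOnCl ?_
      rw [closure_ball z hr.1.ne']
      exact (hf.mono hsub).sub_const _
    have := Complex.norm_deriv_le_of_forall_mem_sphere_norm_le (C := C * r ^ α) hr.1 hdiff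
      (fun w hw => by
        have := h w (hsub (Metric.sphere_subset_closedBall hw)) z (mem_ball_zero_iff.2 hz)
        rwa [mem_sphere_iff_norm.1 hw] at this)
    rw [deriv_sub_const] at this
    rwa [Real.rpow_sub_one hr.1.ne', ← mul_div_assoc]
  have hlim : Filter.Tendsto (fun r : ℝ => C * r ^ (α - 1))
      (nhdsWithin (1 - ‖z‖) (Set.Iio (1 - ‖z‖)))
      (nhds (C * (1 - ‖z‖) ^ (α - 1))) :=
    ((Real.continuousAt_rpow_const _ _ (Or.inl hd.ne')).tendsto.const_mul C).mono_left
      nhdsWithin_le_nhds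
  refine ge_of_tendsto hlim ?_
  filter_upwards [Ioo_mem_nhdsLT hd] with r using hr r

/-- Hardy–Littlewood theorem on the unit disk, with explicit constants:
(i) if `|f'(z)| ≤ C·(1-|z|)^(α-1)` on the disk then `f` is `α`-Hölder with constant `(4/α)·C`;
(ii) conversely, if `f` is `α`-Hölder with constant `C` then
`|f'(z)| ≤ C·(1-|z|)^(α-1)` on the disk. -/
theorem stmt18 (α : ℝ) (hα : α ∈ Set.Ioo (0 : ℝ) 1) (C : ℝ) (hC : 0 ≤ C)
    (f : ℂ → ℂ) (hf : DifferentiableOn ℂ f (Metric.ball 0 1)) :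
    ((∀ z ∈ Metric.ball (0 : ℂ) 1, ‖deriv f z‖ ≤ C * (1 - ‖z‖) ^ (α - 1)) →
      ∀ z ∈ Metric.ball (0 : ℂ) 1, ∀ w ∈ Metric.ball (0 : ℂ) 1,
        ‖f z - f w‖ ≤ (4 / α) * C * ‖z - w‖ ^ α) ∧
    ((∀ z ∈ Metric.ball (0 : ℂ) 1, ∀ w ∈ Metric.ball (0 : ℂ) 1,
        ‖f z - f w‖ ≤ C * ‖z - w‖ ^ α) →
      ∀ z ∈ Metric.ball (0 : ℂ) 1, ‖deriv f z‖ ≤ C * (1 - ‖z‖) ^ (α - 1)) := by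
  refine ⟨fun h z hz w hw => ?_, fun h z hz => norm_deriv_le_rpow_of_holder hf h
    (mem_ball_zero_iff.1 hz)⟩
  rw [mem_ball_zero_iff] at hz hw
  obtain ⟨hα0, hα1⟩ := hα
  rcases eq_or_ne z w with rfl | hzw
  · simp [Real.zero_rpow hα0.ne']
  set d := ‖z - w‖ with hd
  have hd0 : 0 < d := norm_pos_iff.2 (sub_ne_zero.2 hzw)
  have hd2 : d < 2 := by linarith [norm_sub_le z w]
  set m : ℂ := (z + w) / 2 with hm
  have hm1 : ‖m‖ < 1 := by
    rw [hm, norm_div, Complex.norm_ofNat]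
    linarith [norm_add_le z w]
  set p : ℂ := ((1 - d / 2 : ℝ) : ℂ) * m with hp
  have hpn : ‖p‖ = (1 - d / 2) * ‖m‖ := by
    rw [hp, norm_mul, Complex.norm_of_nonneg (by linarith)]
  have hpd : d / 2 ≤ 1 - ‖p‖ := by nlinarith [norm_nonneg m]
  have hp1 : ‖p‖ < 1 := by linarith
  have hmp : ‖((d / 2 : ℝ) : ℂ) * m‖ ≤ d / 2 := by
    rw [norm_mul, Complex.norm_of_nonneg (by linarith)]
    nlinarith
  have hzp : ‖z - p‖ ≤ d := by
    have h1 : z - p = (z - w) / 2 + ((d / 2 : ℝ) : ℂ) * m := by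
      rw [hp, hm]; push_cast; ring
    have h2 := norm_add_le ((z - w) / 2) (((d / 2 : ℝ) : ℂ) * m)
    rw [← h1, norm_div, Complex.norm_ofNat, ← hd] at h2
    linarith
  have hwp : ‖w - p‖ ≤ d := by
    have h1 : w - p = ((d / 2 : ℝ) : ℂ) * m - (z - w) / 2 := by
      rw [hp, hm]; push_cast; ring
    have h2 := norm_sub_le (((d / 2 : ℝ) : ℂ) * m) ((z - w) / 2)
    rw [← h1, norm_div, Complex.norm_ofNat, ← hd] at h2
    linarith
  have hfar : (1 - ‖p‖) ^ (α - 1) * d ≤ 2 * d ^ α := by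
    calc (1 - ‖p‖) ^ (α - 1) * d ≤ (d / 2) ^ (α - 1) * d := by
          gcongr ?_ * d
          exact Real.rpow_le_rpow_of_nonpos (by linarith) hpd (by linarith)
      _ = 2 * (d / 2) ^ α := by
          rw [Real.rpow_sub_one (by positivity)]
          field_simp
      _ ≤ 2 * d ^ α := by
          gcongr
          linarith
  have hz' := norm_sub_le_of_norm_deriv_le_rpow_s18 ⟨hα0, hα1⟩ hC hf h hz hp1
  have hw' := norm_sub_le_of_norm_deriv_le_rpow_s18 ⟨hα0, hα1⟩ hC hf h hw hp1
  have hnn : 0 ≤ (1 - ‖p‖) ^ (α - 1) := Real.rpow_nonneg (by linarith) _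
  calc ‖f z - f w‖ = ‖(f z - f p) - (f w - f p)‖ := by rw [sub_sub_sub_cancel_right]
    _ ≤ ‖f z - f p‖ + ‖f w - f p‖ := norm_sub_le _ _
    _ ≤ C / α * (1 - ‖p‖) ^ (α - 1) * d + C / α * (1 - ‖p‖) ^ (α - 1) * d := by
        refine add_le_add (hz'.trans ?_) (hw'.trans ?_) <;> gcongr
    _ = 2 * (C / α) * ((1 - ‖p‖) ^ (α - 1) * d) := by ring
    _ ≤ 2 * (C / α) * (2 * d ^ α) := by gcongr
    _ = 4 / α * C * d ^ α := by ring
end
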